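/- arXiv:2602.17447 — 2 statements merged into one kernel-verified Lean document; each statement's English description precedes it below -/
import Mathlib

section
/- Assume (A5), (A6), (A7), and (A8). Then for every m₀ ∈ 𝓟(Y), the functional 𝓙 admits a minimizer in 𝓟_{m₀}(X). If in addition H is symmetric, then there exists an equilibrium Q ∈ 𝓟_{m₀}(X), i.e., a measure Q with π_#Q = m₀, ∫_X F(x,Q) dQ(x) < +∞, and such that for Q-almost every x ∈ X, F(x,Q) = inf{F(z,Q) : z ∈ X, π(z) = π(x)}. -/
open MeasureTheory Filter Topology Set
open scoped ENNReal

noncomputable section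

/-- The individual cost of `x` when the population plays `Q`:
`F(x,Q) = L(x) + ∫ H(x,·) dQ`. -/
def Fcost {X : Type*} [MeasurableSpace X] (L : X → ℝ≥0∞) (H : X → X → ℝ≥0∞)
    (x : X) (Q : Measure X) : ℝ≥0∞ :=
  L x + ∫⁻ x', H x x' ∂Q

/-- `J(x,x̃) = L(x) + L(x̃) + H(x,x̃)`. -/
def Jcost {X : Type*} (L : X → ℝ≥0∞) (H : X → X → ℝ≥0∞) (x x' : X) : ℝ≥0∞ :=
  L x + L x' + H x x'

/-- The potential `𝓙(Q) = ∫∫ J d(Q ⊗ Q)`. -/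
def Jpot {X : Type*} [MeasurableSpace X] (L : X → ℝ≥0∞) (H : X → X → ℝ≥0∞)
    (Q : Measure X) : ℝ≥0∞ :=
  ∫⁻ p : X × X, Jcost L H p.1 p.2 ∂(Q.prod Q)

section Semicontinuity

variable {Ω : Type*} [TopologicalSpace Ω] [MeasurableSpace Ω]

/-- Lower semicontinuous integrands satisfy the Fatou-type inequality along sequences of measures
whose mass on every open set is asymptotically at least that of the limit measure. -/
lemma LowerSemicontinuous.lintegral_le_liminf_lintegral [OpensMeasurableSpace Ω]
    {μ : Measure Ω} {μs : ℕ → Measure Ω} {f : Ω → ℝ≥0∞} (hf : LowerSemicontinuous f)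
    (h_opens : ∀ G, IsOpen G → μ G ≤ atTop.liminf (fun i ↦ μs i G)) :
    ∫⁻ x, f x ∂μ ≤ atTop.liminf (fun i ↦ ∫⁻ x, f x ∂(μs i)) := by
  have hfm : Measurable f := hf.measurable
  have trunc_meas (n : ℕ) : Measurable fun x ↦ (min (f x) n).toReal :=
    (hfm.min measurable_const).ennreal_toReal
  have trunc_open (n : ℕ) {t : ℝ} (ht : 0 < t) : IsOpen {x | t < (min (f x) n).toReal} := by
    have : {x | t < (min (f x) n).toReal} = {x | ENNReal.ofReal t < f x ∧ ENNReal.ofReal t < n} := by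
      ext x
      have hn : min (f x) n ≠ ⊤ := ne_top_of_le_ne_top (ENNReal.natCast_ne_top n) (min_le_right _ _)
      simp only [mem_ofPred_eq]
      rw [← ENNReal.ofReal_lt_iff_lt_toReal ht.le hn, lt_min_iff]
    rw [this]
    exact (hf.isOpen_preimage _).and isOpen_const
  have trunc_le (n : ℕ) : ∫⁻ x, min (f x) n ∂μ ≤ atTop.liminf (fun i ↦ ∫⁻ x, f x ∂(μs i)) := by
    have toReal_eq (x : Ω) : min (f x) n = ENNReal.ofReal (min (f x) n).toReal :=
      (ENNReal.ofReal_toReal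
        (ne_top_of_le_ne_top (ENNReal.natCast_ne_top n) (min_le_right _ _))).symm
    have layer (ν : Measure Ω) : ∫⁻ x, min (f x) n ∂ν =
        ∫⁻ t in Ioi (0 : ℝ), ν {x | t < (min (f x) n).toReal} := by
      rw [← lintegral_eq_lintegral_meas_lt ν (.of_forall fun _ ↦ ENNReal.toReal_nonneg)
        (trunc_meas n).aemeasurable]
      exact lintegral_congr toReal_eq
    calc ∫⁻ x, min (f x) n ∂μ
        = ∫⁻ t in Ioi (0 : ℝ), μ {x | t < (min (f x) n).toReal} := layer μ
      _ ≤ ∫⁻ t in Ioi (0 : ℝ), atTop.liminf fun i ↦ μs i {x | t < (min (f x) n).toReal} :=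
          setLIntegral_mono' measurableSet_Ioi fun t ht ↦ h_opens _ (trunc_open n ht)
      _ ≤ atTop.liminf fun i ↦ ∫⁻ t in Ioi (0 : ℝ), μs i {x | t < (min (f x) n).toReal} :=
          lintegral_liminf_le fun i ↦ Antitone.measurable fun s t hst ↦
            measure_mono fun ω hω ↦ lt_of_le_of_lt hst hω
      _ ≤ atTop.liminf fun i ↦ ∫⁻ x, f x ∂(μs i) := by
          refine liminf_le_liminf (.of_forall fun i ↦ ?_)
          rw [← layer]
          exact lintegral_mono fun x ↦ min_le_left _ _
  have sup_eq : ∫⁻ x, f x ∂μ = ⨆ n : ℕ, ∫⁻ x, min (f x) n ∂μ := by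
    rw [← lintegral_iSup (fun n ↦ hfm.min measurable_const)
      fun m n hmn x ↦ min_le_min_left _ (by exact_mod_cast hmn)]
    refine lintegral_congr fun x ↦ ?_
    rw [← inf_iSup_eq, ENNReal.iSup_natCast, inf_top_eq]
  rw [sup_eq]
  exact iSup_le trunc_le

lemma LowerSemicontinuous.lintegral_probabilityMeasure [TopologicalSpace.PseudoMetrizableSpace Ω]
    [SecondCountableTopology Ω] [BorelSpace Ω] {f : Ω → ℝ≥0∞} (hf : LowerSemicontinuous f) :
    LowerSemicontinuous fun μ : ProbabilityMeasure Ω ↦ ∫⁻ x, f x ∂(μ : Measure Ω) := by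
  refine lowerSemicontinuous_iff_isClosed_preimage.2 fun c ↦ IsSeqClosed.isClosed ?_
  intro μs μ hμs hlim
  refine (hf.lintegral_le_liminf_lintegral fun G hG ↦
    ProbabilityMeasure.le_liminf_measure_open_of_tendsto hlim hG).trans ?_
  exact (liminf_le_liminf (.of_forall hμs)).trans_eq (liminf_const _)

lemma LowerSemicontinuous.lintegral_prod_right {Z : Type*} [TopologicalSpace Z]
    [SequentialSpace Z] [OpensMeasurableSpace Ω] {f : Z × Ω → ℝ≥0∞}
    (hf : LowerSemicontinuous f) (μ : Measure Ω) :
    LowerSemicontinuous fun z ↦ ∫⁻ x, f (z, x) ∂μ := by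
  refine lowerSemicontinuous_iff_isClosed_preimage.2 fun c ↦ IsSeqClosed.isClosed ?_
  intro zs z hzs hlim
  have hmeas (z : Z) : Measurable fun x ↦ f (z, x) :=
    (hf.comp (Continuous.prodMk_right z)).measurable
  calc ∫⁻ x, f (z, x) ∂μ ≤ ∫⁻ x, atTop.liminf (fun n ↦ f (zs n, x)) ∂μ := by
        refine lintegral_mono fun x ↦ ?_
        have hx : LowerSemicontinuous fun z ↦ f (z, x) :=
          hf.comp (Continuous.prodMk_left x)
        exact (lowerSemicontinuous_iff_le_liminf.1 hx z).trans
          (liminf_le_liminf_of_le (u := fun z ↦ f (z, x)) hlim)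
    _ ≤ atTop.liminf fun n ↦ ∫⁻ x, f (zs n, x) ∂μ := lintegral_liminf_le fun n ↦ hmeas _
    _ ≤ c := (liminf_le_liminf (.of_forall hzs)).trans_eq (liminf_const _)

end Semicontinuity

section Lifting

variable {X Y : Type*} [TopologicalSpace X] [MeasurableSpace X] [BorelSpace X]
  [TopologicalSpace Y] [T2Space Y] [MeasurableSpace Y] [BorelSpace Y]

/-- A continuous map defined on a compact set of reals has a measurable section, given by the
smallest element of each fibre. -/
lemma exists_measurable_section_of_isCompact_real {E : Set ℝ} (hE : IsCompact E) (hne : E.Nonempty)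
    {f : E → Y} (hf : Continuous f) :
    ∃ s : Y → E, Measurable s ∧ ∀ y ∈ range f, f (s y) = y := by
  classical
  have : CompactSpace E := isCompact_iff_compactSpace.1 hE
  have exists_least (y : Y) (hy : y ∈ range f) : ∃ e : E, f e = y ∧ ∀ e', f e' = y → e ≤ e' := by
    obtain ⟨e₀, he₀⟩ := hy
    have hfib : IsCompact (f ⁻¹' {y}) := (isClosed_singleton.preimage hf).isCompact
    obtain ⟨e, he, hmin⟩ := hfib.exists_isMinOn ⟨e₀, he₀⟩ continuous_subtype_val.continuousOn
    exact ⟨e, he, fun e' he' ↦ hmin he'⟩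
  have : Nonempty E := hne.to_subtype
  choose! s hs hmin using exists_least
  have e₀ : E := ⟨_, hne.some_mem⟩
  have hrange : MeasurableSet (range f) := (isCompact_range hf).measurableSet
  refine ⟨fun y ↦ if y ∈ range f then s y else e₀, ?_, fun y hy ↦ by simp only [if_pos hy, hs y hy]⟩
  refine (MeasurableEmbedding.subtype_coe hE.measurableSet).measurable_comp_iff.1
    (measurable_of_Iic fun a ↦ ?_)
  have sublevel_eq : (Subtype.val ∘ fun y ↦ if y ∈ range f then s y else e₀) ⁻¹' Iic a =
      f '' (Subtype.val ⁻¹' Iic a) ∪ (range f)ᶜ ∩ {_y | (e₀ : ℝ) ≤ a} := by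
    ext y
    by_cases hy : y ∈ range f
    · simp only [mem_preimage, Function.comp_apply, mem_Iic, mem_union, mem_image,
        mem_inter_iff, mem_compl_iff, hy, not_true_eq_false, false_and, or_false]
      exact ⟨fun h ↦ ⟨s y, h, hs y hy⟩, fun ⟨e, he, hey⟩ ↦ le_trans (hmin y hy e hey) he⟩
    · have : y ∉ f '' (Subtype.val ⁻¹' Iic a) := fun h ↦ hy (image_subset_range _ _ h)
      simp only [mem_preimage, Function.comp_apply, mem_Iic, mem_union, this, false_or, if_false,
        mem_inter_iff, mem_compl_iff, hy, not_false_eq_true, true_and, mem_ofPred_eq]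
  rw [sublevel_eq]
  have : IsCompact (f '' (Subtype.val ⁻¹' Iic a)) :=
    (isClosed_Iic.preimage continuous_subtype_val).isCompact.image hf
  exact this.measurableSet.union (hrange.compl.inter (MeasurableSet.const _))

lemma exists_measurable_section_of_isCompact [TopologicalSpace.MetrizableSpace X] {π : X → Y}
    (hπ : Continuous π) {K : Set X} (hK : IsCompact K) (hne : K.Nonempty) :
    ∃ s : Y → X, Measurable s ∧ ∀ y ∈ π '' K, s y ∈ K ∧ π (s y) = y := by
  have : CompactSpace K := isCompact_iff_compactSpace.1 hK
  have : Nonempty K := hne.to_subtype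
  let : MetricSpace K := TopologicalSpace.metrizableSpaceMetric K
  obtain ⟨g, hg, hg_surj⟩ := exists_nat_bool_continuous_surjective_of_compact K
  let h : cantorSet → K := g ∘ cantorSetHomeomorphNatToBool
  have hh : Continuous h := hg.comp cantorSetHomeomorphNatToBool.continuous
  have hh_surj : Function.Surjective h := hg_surj.comp cantorSetHomeomorphNatToBool.surjective
  obtain ⟨s, hs, hs_section⟩ := exists_measurable_section_of_isCompact_real isCompact_cantorSet
    ⟨0, zero_mem_cantorSet⟩ (hπ.comp (continuous_subtype_val.comp hh))
  refine ⟨fun y ↦ h (s y), (continuous_subtype_val.comp hh).measurable.comp hs, ?_⟩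
  rintro _ ⟨x, hx, rfl⟩
  obtain ⟨c, hc⟩ := hh_surj ⟨x, hx⟩
  exact ⟨(h _).2, hs_section _ ⟨c, by simp [hc]⟩⟩

/-- A measure carried by the image of a compact set lifts to a measure carried by that set. -/
lemma exists_measure_map_eq_of_isCompact [TopologicalSpace.MetrizableSpace X] {π : X → Y}
    (hπ : Continuous π) {K : Set X} (hK : IsCompact K) (hne : K.Nonempty) {m : Measure Y}
    (hm : m (π '' K)ᶜ = 0) :
    ∃ Q : Measure X, Q.map π = m ∧ ∀ᵐ x ∂Q, x ∈ K := by
  obtain ⟨s, hs, hsK⟩ := exists_measurable_section_of_isCompact hπ hK hne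
  have hae : ∀ᵐ y ∂m, y ∈ π '' K := hm
  refine ⟨m.map s, ?_, ?_⟩
  · rw [Measure.map_map hπ.measurable hs,
      Measure.map_congr (f := π ∘ s) (g := id) (hae.mono fun y hy ↦ (hsK y hy).2), Measure.map_id]
  · exact (ae_map_iff hs.aemeasurable hK.measurableSet).2 (hae.mono fun y hy ↦ (hsK y hy).1)

end Lifting

section Potential

variable {X : Type*} [MeasurableSpace X] {L : X → ℝ≥0∞} {H : X → X → ℝ≥0∞}

lemma Jpot_eq (hL : Measurable L) (hH : Measurable (Function.uncurry H)) (Q : Measure X)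
    [IsProbabilityMeasure Q] :
    Jpot L H Q = 2 * ∫⁻ x, L x ∂Q + ∫⁻ x, ∫⁻ x', H x x' ∂Q ∂Q := by
  have hJ : Measurable fun p : X × X ↦ Jcost L H p.1 p.2 :=
    ((hL.comp measurable_fst).add (hL.comp measurable_snd)).add hH
  have inner (x : X) : ∫⁻ x', Jcost L H x x' ∂Q = L x + ∫⁻ x', L x' ∂Q + ∫⁻ x', H x x' ∂Q := by
    simp only [Jcost]
    rw [lintegral_add_left (by fun_prop), lintegral_add_left measurable_const]
    simp
  rw [Jpot, lintegral_prod _ hJ.aemeasurable]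
  simp only [inner]
  rw [lintegral_add_left (by fun_prop), lintegral_add_left hL]
  simp [two_mul]

lemma lintegral_Fcost (hL : Measurable L) (Q P : Measure X) :
    ∫⁻ x, Fcost L H x Q ∂P = ∫⁻ x, L x ∂P + ∫⁻ x, ∫⁻ x', H x x' ∂Q ∂P :=
  lintegral_add_left hL _

lemma lintegral_lintegral_ne_top {C : ℝ≥0∞} (hC : C ≠ ⊤) (hL : Measurable L)
    (hHC : ∀ x x', H x x' ≤ C * (L x + L x' + 1)) {Q P : Measure X} [IsProbabilityMeasure Q]
    [IsProbabilityMeasure P] (hQ : ∫⁻ x, L x ∂Q ≠ ⊤) (hP : ∫⁻ x, L x ∂P ≠ ⊤) :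
    ∫⁻ x, ∫⁻ x', H x x' ∂Q ∂P ≠ ⊤ := by
  refine ne_top_of_le_ne_top (b := C * (∫⁻ x, L x ∂P + ∫⁻ x, L x ∂Q + 1)) ?_ ?_
  · finiteness
  calc ∫⁻ x, ∫⁻ x', H x x' ∂Q ∂P ≤ ∫⁻ x, ∫⁻ x', C * (L x + L x' + 1) ∂Q ∂P :=
        lintegral_mono fun x ↦ lintegral_mono fun x' ↦ hHC x x'
    _ = C * (∫⁻ x, L x ∂P + ∫⁻ x, L x ∂Q + 1) := by
        have inner (x : X) : ∫⁻ x', C * (L x + L x' + 1) ∂Q = C * (L x + (∫⁻ x', L x' ∂Q + 1)) := by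
          rw [lintegral_const_mul _ (by fun_prop), lintegral_add_right _ measurable_const,
            lintegral_add_left measurable_const]
          simp [add_assoc]
        simp only [inner]
        rw [lintegral_const_mul _ (by fun_prop), lintegral_add_right _ measurable_const]
        simp [add_assoc]

/-- First-order optimality condition: when the potential does not decrease along the segment from
`Q` to `P`, its derivative `2 ∫ F(·, Q) d(P - Q)` at `Q` is nonnegative. -/
lemma lintegral_Fcost_le_of_forall_Jpot_le {C : ℝ≥0∞} (hC : C ≠ ⊤) (hL : Measurable L)
    (hH : Measurable (Function.uncurry H)) (hHC : ∀ x x', H x x' ≤ C * (L x + L x' + 1))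
    (hsymm : ∀ x x', H x x' = H x' x) {Q P : Measure X} [IsProbabilityMeasure Q]
    [IsProbabilityMeasure P] (hQ : ∫⁻ x, L x ∂Q ≠ ⊤) (hP : ∫⁻ x, L x ∂P ≠ ⊤)
    (hmin : ∀ a b : ℝ≥0∞, a + b = 1 → Jpot L H Q ≤ Jpot L H (a • Q + b • P)) :
    ∫⁻ x, Fcost L H x Q ∂Q ≤ ∫⁻ x, Fcost L H x Q ∂P := by
  have hQQ := lintegral_lintegral_ne_top hC hL hHC hQ hQ
  have hPQ := lintegral_lintegral_ne_top hC hL hHC hQ hP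
  have hPP := lintegral_lintegral_ne_top hC hL hHC hP hP
  have hswap : ∫⁻ x, ∫⁻ x', H x x' ∂P ∂Q = ∫⁻ x, ∫⁻ x', H x x' ∂Q ∂P := by
    rw [lintegral_lintegral_swap hH.aemeasurable]
    simp only [hsymm]
  have hmeas (ν : Measure X) [SFinite ν] : Measurable fun x ↦ ∫⁻ x', H x x' ∂ν :=
    hH.lintegral_prod_right
  rw [lintegral_Fcost hL, lintegral_Fcost hL]
  have key (t : ℝ) (ht : t ∈ Ioo (0 : ℝ) 1) :
      2 * (∫⁻ x, L x ∂Q).toReal + (∫⁻ x, ∫⁻ x', H x x' ∂Q ∂Q).toReal ≤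
        2 * ((1 - t) * (∫⁻ x, L x ∂Q).toReal + t * (∫⁻ x, L x ∂P).toReal) +
        ((1 - t) * ((1 - t) * (∫⁻ x, ∫⁻ x', H x x' ∂Q ∂Q).toReal +
            t * (∫⁻ x, ∫⁻ x', H x x' ∂Q ∂P).toReal) +
          t * ((1 - t) * (∫⁻ x, ∫⁻ x', H x x' ∂Q ∂P).toReal +
            t * (∫⁻ x, ∫⁻ x', H x x' ∂P ∂P).toReal)) := by
    have ht₁ : 0 ≤ 1 - t := by linarith [ht.2]
    have hab : ENNReal.ofReal (1 - t) + ENNReal.ofReal t = 1 := by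
      rw [← ENNReal.ofReal_add ht₁ ht.1.le]; simp
    have : IsProbabilityMeasure (ENNReal.ofReal (1 - t) • Q + ENNReal.ofReal t • P) :=
      ⟨by simp [hab]⟩
    have h := hmin _ _ hab
    rw [Jpot_eq hL hH, Jpot_eq hL hH] at h
    simp only [lintegral_add_measure, lintegral_smul_measure, smul_eq_mul] at h
    rw [lintegral_add_left ((hmeas Q).const_mul _), lintegral_add_left ((hmeas Q).const_mul _),
      lintegral_const_mul _ (hmeas Q), lintegral_const_mul _ (hmeas Q),
      lintegral_const_mul _ (hmeas P), lintegral_const_mul _ (hmeas P), hswap] at h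
    lift ∫⁻ x, L x ∂Q to NNReal using hQ with lQ
    lift ∫⁻ x, L x ∂P to NNReal using hP with lR
    lift ∫⁻ x, ∫⁻ x', H x x' ∂Q ∂Q to NNReal using hQQ with hQQ
    lift ∫⁻ x, ∫⁻ x', H x x' ∂Q ∂P to NNReal using hPQ with hPQ
    lift ∫⁻ x, ∫⁻ x', H x x' ∂P ∂P to NNReal using hPP with hPP
    lift t to NNReal using ht.1.le
    lift 1 - (t : ℝ) to NNReal using ht₁ with u
    simp only [ENNReal.ofReal_coe_nnreal, ENNReal.coe_toReal] at h ⊢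
    exact_mod_cast h
  rw [← ENNReal.toReal_le_toReal (by finiteness) (by finiteness),
    ENNReal.toReal_add hQ hQQ, ENNReal.toReal_add hP hPQ]
  generalize (∫⁻ x, L x ∂Q).toReal = lQ at *
  generalize (∫⁻ x, L x ∂P).toReal = lR at *
  generalize (∫⁻ x, ∫⁻ x', H x x' ∂Q ∂Q).toReal = hQ at *
  generalize (∫⁻ x, ∫⁻ x', H x x' ∂Q ∂P).toReal = hM at *
  generalize (∫⁻ x, ∫⁻ x', H x x' ∂P ∂P).toReal = hP at *
  have quotient_le (t : ℝ) (ht : t ∈ Ioo (0 : ℝ) 1) :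
      2 * (lQ + hQ) ≤ 2 * (lR + hM) + t * (hQ - 2 * hM + hP) :=
    le_of_mul_le_mul_left (by nlinarith [key t ht]) ht.1
  have hlim : Tendsto (fun t : ℝ ↦ 2 * (lR + hM) + t * (hQ - 2 * hM + hP)) (𝓝[>] 0)
      (𝓝 (2 * (lR + hM) + 0 * (hQ - 2 * hM + hP))) :=
    (Continuous.tendsto (by fun_prop) 0).mono_left nhdsWithin_le_nhds
  have := ge_of_tendsto hlim (eventually_of_mem (Ioo_mem_nhdsGT one_pos) quotient_le)
  linarith

end Potential

/-- Bounds on the integral of a function with compact sublevel sets give tightness. -/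
lemma isTightMeasureSet_of_lintegral_le {X : Type*} [TopologicalSpace X] [MeasurableSpace X]
    {L : X → ℝ≥0∞} (hL : Measurable L)
    (hcompact : ∀ c : ℝ, 0 < c → IsCompact {x | L x ≤ ENNReal.ofReal c}) {S : Set (Measure X)}
    {B : ℝ≥0∞} (hB : B ≠ ⊤) (hS : ∀ μ ∈ S, ∫⁻ x, L x ∂μ ≤ B) : IsTightMeasureSet S := by
  refine isTightMeasureSet_iff_exists_isCompact_measure_compl_le.2 fun ε hε ↦ ?_
  obtain ⟨n, hn⟩ := ENNReal.exists_nat_gt (ENNReal.div_ne_top hB hε.ne')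
  have hn_pos : n ≠ 0 := by rintro rfl; simp at hn
  refine ⟨_, hcompact n (by positivity), fun μ hμ ↦ ?_⟩
  calc μ {x | L x ≤ ENNReal.ofReal n}ᶜ ≤ μ {x | (n : ℝ≥0∞) ≤ L x} := by
        refine measure_mono fun x hx ↦ ?_
        simp only [ENNReal.ofReal_natCast, mem_compl_iff, mem_ofPred_eq, not_le] at hx
        exact hx.le
    _ ≤ (∫⁻ x, L x ∂μ) / n := meas_ge_le_lintegral_div hL.aemeasurable (by simpa) (by simp)
    _ ≤ B / n := by gcongr; exact hS μ hμ
    _ ≤ ε := by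
        refine ENNReal.div_le_of_le_mul' ?_
        rw [ENNReal.div_lt_iff (.inl hε.ne') (.inr hB)] at hn
        exact hn.le

section Equilibrium

variable {X Y : Type*} [TopologicalSpace X] [PolishSpace X] [MeasurableSpace X] [BorelSpace X]
  [TopologicalSpace Y] [PolishSpace Y] [MeasurableSpace Y] [BorelSpace Y]
  {π : X → Y} {L : X → ℝ≥0∞} {H : X → X → ℝ≥0∞}

lemma lowerSemicontinuous_Jpot (hJ : LowerSemicontinuous fun p : X × X ↦ Jcost L H p.1 p.2) :
    LowerSemicontinuous fun Q : ProbabilityMeasure X ↦ Jpot L H Q := by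
  have hdiag : Continuous fun Q : ProbabilityMeasure X ↦ Q.prod Q :=
    ProbabilityMeasure.continuous_prod.comp (continuous_id.prodMk continuous_id)
  exact hJ.lintegral_probabilityMeasure.comp hdiag

lemma exists_Jpot_minimizer (hπ : Continuous π) (hL : Measurable L)
    (hH : Measurable (Function.uncurry H))
    (hJ : LowerSemicontinuous fun p : X × X ↦ Jcost L H p.1 p.2)
    (hcompact : ∀ c : ℝ, 0 < c → IsCompact {x | L x ≤ ENNReal.ofReal c}) {m₀ : Measure Y}
    {P : Measure X} [IsProbabilityMeasure P] (hPπ : P.map π = m₀) (hP : Jpot L H P ≠ ⊤) :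
    ∃ Q : Measure X, IsProbabilityMeasure Q ∧ Q.map π = m₀ ∧
      ∀ Q' : Measure X, IsProbabilityMeasure Q' → Q'.map π = m₀ → Jpot L H Q ≤ Jpot L H Q' := by
  let S : Set (ProbabilityMeasure X) :=
    {Q | (Q : Measure X).map π = m₀} ∩ {Q | Jpot L H Q ≤ Jpot L H P}
  let P₀ : ProbabilityMeasure X := ⟨P, ‹_›⟩
  have hPS : P₀ ∈ S := ⟨hPπ, le_refl (Jpot L H P)⟩
  have hm₀ : IsProbabilityMeasure m₀ :=
    hPπ ▸ Measure.isProbabilityMeasure_map hπ.measurable.aemeasurable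
  have hclosed : IsClosed S := by
    refine IsClosed.inter ?_ ((lowerSemicontinuous_Jpot hJ).isClosed_preimage _)
    let m₁ : ProbabilityMeasure Y := ⟨m₀, hm₀⟩
    convert (isClosed_singleton (x := m₁)).preimage
      (ProbabilityMeasure.continuous_map hπ) using 1
    ext Q
    exact (Subtype.ext_iff (a1 := Q.map hπ.measurable.aemeasurable) (a2 := m₁)).symm
  have htight : IsTightMeasureSet {((μ : ProbabilityMeasure X) : Measure X) | μ ∈ S} := by
    refine isTightMeasureSet_of_lintegral_le hL hcompact hP ?_
    rintro _ ⟨Q, hQ, rfl⟩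
    refine le_trans ?_ hQ.2
    rw [Jpot_eq hL hH]
    exact (le_mul_of_one_le_left zero_le one_le_two).trans le_self_add
  have hScompact : IsCompact S := hclosed.closure_eq ▸ isCompact_closure_of_isTightMeasureSet htight
  obtain ⟨Q, hQ, hmin⟩ :=
    ((lowerSemicontinuous_Jpot hJ).lowerSemicontinuousOn S).exists_isMinOn ⟨P₀, hPS⟩ hScompact
  refine ⟨Q, Q.2, hQ.1, fun Q' hQ'prob hQ' ↦ ?_⟩
  by_cases hle : Jpot L H Q' ≤ Jpot L H P
  · let Q₁ : ProbabilityMeasure X := ⟨Q', hQ'prob⟩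
    exact hmin (show Q₁ ∈ S from ⟨hQ', hle⟩)
  · exact hQ.2.trans (not_le.1 hle).le

lemma lowerSemicontinuous_Fcost (hL : Measurable L)
    (hJ : LowerSemicontinuous fun p : X × X ↦ Jcost L H p.1 p.2) {Q : Measure X}
    [IsProbabilityMeasure Q] (hQ : ∫⁻ x, L x ∂Q ≠ ⊤) :
    LowerSemicontinuous fun x ↦ Fcost L H x Q := by
  have hJQ := hJ.lintegral_prod_right Q
  have lintegral_Jcost (x : X) : ∫⁻ x', Jcost L H x x' ∂Q = Fcost L H x Q + ∫⁻ x', L x' ∂Q := by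
    simp only [Jcost, Fcost]
    rw [lintegral_add_left (by fun_prop), lintegral_add_left measurable_const]
    simp [add_right_comm]
  refine lowerSemicontinuous_iff_isClosed_preimage.2 fun c ↦ ?_
  convert hJQ.isClosed_preimage (c + ∫⁻ x, L x ∂Q) using 1
  ext x
  simp [lintegral_Jcost, ENNReal.add_le_add_iff_right hQ]

/-- A positive mass of players which can all bring their cost from above `c` down to at most `c`
contradicts first-order optimality. -/
lemma measure_improvable_eq_zero (hπ : Continuous π)
    {m₀ : Measure Y} {Q : Measure X} [IsProbabilityMeasure Q] (hQπ : Q.map π = m₀)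
    (hF : Measurable fun x ↦ Fcost L H x Q) (hFfin : ∫⁻ x, Fcost L H x Q ∂Q ≠ ⊤)
    (hopt : ∀ P : Measure X, IsProbabilityMeasure P → P.map π = m₀ → ∫⁻ x, L x ∂P ≠ ⊤ →
      ∫⁻ x, Fcost L H x Q ∂Q ≤ ∫⁻ x, Fcost L H x Q ∂P)
    {c : ℝ≥0∞} (hc : c ≠ ⊤) (hK : IsCompact {x | Fcost L H x Q ≤ c}) :
    Q ({x | c < Fcost L H x Q} ∩ π ⁻¹' (π '' {x | Fcost L H x Q ≤ c})) = 0 := by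
  set K := {x | Fcost L H x Q ≤ c}
  set A := {x | c < Fcost L H x Q} ∩ π ⁻¹' (π '' K)
  have hπK : MeasurableSet (π '' K) := (hK.image hπ).measurableSet
  have hA : MeasurableSet A :=
    (measurableSet_lt measurable_const hF).inter (hπ.measurable hπK)
  by_contra hQA
  obtain ⟨x₀, -, z₀, hz₀, -⟩ := nonempty_of_measure_ne_zero hQA
  have hcarried : (Q.restrict A).map π (π '' K)ᶜ = 0 := by
    rw [Measure.map_apply hπ.measurable hπK.compl,
      Measure.restrict_apply (hπ.measurable hπK.compl)]
    convert measure_empty (μ := Q)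
    exact eq_empty_of_forall_notMem fun x hx ↦ hx.1 hx.2.2
  obtain ⟨P, hPπ, hPK⟩ := exists_measure_map_eq_of_isCompact hπ hK ⟨z₀, hz₀⟩ hcarried
  have hPmass : P univ = Q A := by
    have := congrArg (fun m ↦ m univ) hPπ
    simpa [Measure.map_apply hπ.measurable MeasurableSet.univ] using this
  have hmap : (Q.restrict Aᶜ + P).map π = m₀ := by
    rw [Measure.map_add _ _ hπ.measurable, hPπ, ← Measure.map_add _ _ hπ.measurable,
      Measure.restrict_compl_add_restrict hA, hQπ]
  have hprob : IsProbabilityMeasure (Q.restrict Aᶜ + P) := by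
    refine ⟨?_⟩
    rw [Measure.add_apply, Measure.restrict_apply_univ, hPmass, add_comm,
      measure_add_measure_compl hA, measure_univ]
  have hcompl_fin : ∫⁻ x in Aᶜ, Fcost L H x Q ∂Q ≠ ⊤ :=
    ne_top_of_le_ne_top hFfin (setLIntegral_le_lintegral _ _)
  have hlt : ∫⁻ x, Fcost L H x Q ∂(Q.restrict Aᶜ + P) < ∫⁻ x, Fcost L H x Q ∂Q := by
    calc ∫⁻ x, Fcost L H x Q ∂(Q.restrict Aᶜ + P)
        = ∫⁻ x in Aᶜ, Fcost L H x Q ∂Q + ∫⁻ x, Fcost L H x Q ∂P := lintegral_add_measure ..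
      _ ≤ ∫⁻ x in Aᶜ, Fcost L H x Q ∂Q + ∫⁻ x in A, c ∂Q := by
          refine add_le_add_right ?_ _
          calc ∫⁻ x, Fcost L H x Q ∂P ≤ ∫⁻ x, c ∂P := lintegral_mono_ae hPK
            _ = ∫⁻ x in A, c ∂Q := by simp [hPmass]
      _ < ∫⁻ x in Aᶜ, Fcost L H x Q ∂Q + ∫⁻ x in A, Fcost L H x Q ∂Q := by
          refine ENNReal.add_lt_add_left hcompl_fin ?_
          refine setLIntegral_strict_mono hA hQA hF ?_ (.of_forall fun x hx ↦ hx.1)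
          simpa using ENNReal.mul_ne_top hc (measure_ne_top Q A)
      _ = ∫⁻ x, Fcost L H x Q ∂Q := by rw [add_comm, lintegral_add_compl _ hA]
  refine hlt.not_ge (hopt _ hprob hmap ?_)
  exact ne_top_of_le_ne_top hlt.ne_top (lintegral_mono fun x ↦ le_self_add)

lemma ae_Fcost_eq_iInf (hπ : Continuous π) (hL : Measurable L)
    (hJ : LowerSemicontinuous fun p : X × X ↦ Jcost L H p.1 p.2)
    (hcompact : ∀ c : ℝ, 0 < c → IsCompact {x | L x ≤ ENNReal.ofReal c})
    {m₀ : Measure Y} {Q : Measure X} [IsProbabilityMeasure Q] (hQπ : Q.map π = m₀)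
    (hFfin : ∫⁻ x, Fcost L H x Q ∂Q ≠ ⊤)
    (hopt : ∀ P : Measure X, IsProbabilityMeasure P → P.map π = m₀ → ∫⁻ x, L x ∂P ≠ ⊤ →
      ∫⁻ x, Fcost L H x Q ∂Q ≤ ∫⁻ x, Fcost L H x Q ∂P) :
    ∀ᵐ x ∂Q, Fcost L H x Q = ⨅ (z : X) (_ : π z = π x), Fcost L H z Q := by
  have hQL : ∫⁻ x, L x ∂Q ≠ ⊤ :=
    ne_top_of_le_ne_top hFfin (lintegral_mono fun x ↦ le_self_add)
  have hF := lowerSemicontinuous_Fcost hL hJ hQL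
  have hnull (q : ℚ) (hq : 0 < q) :
      ∀ᵐ x ∂Q, x ∉ {x | ENNReal.ofReal q < Fcost L H x Q} ∩
        π ⁻¹' (π '' {x | Fcost L H x Q ≤ ENNReal.ofReal q}) := by
    refine measure_eq_zero_iff_ae_notMem.1
      (measure_improvable_eq_zero hπ hQπ hF.measurable hFfin hopt ENNReal.ofReal_ne_top ?_)
    exact (hcompact q (by exact_mod_cast hq)).of_isClosed_subset (hF.isClosed_preimage _)
      fun x (hx : L x + _ ≤ _) ↦ le_self_add.trans hx
  have hall : ∀ᵐ x ∂Q, ∀ q : ℚ, 0 < q → x ∉ {x | ENNReal.ofReal q < Fcost L H x Q} ∩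
      π ⁻¹' (π '' {x | Fcost L H x Q ≤ ENNReal.ofReal q}) :=
    ae_all_iff.2 fun q ↦ ae_all_iff.2 (hnull q)
  filter_upwards [hall] with x hx
  refine le_antisymm (le_iInf₂ fun z hz ↦ ?_)
    (iInf₂_le (f := fun z (_ : π z = π x) ↦ Fcost L H z Q) x rfl)
  by_contra! hlt
  obtain ⟨q, -, hzq, hqx⟩ := ENNReal.lt_iff_exists_rat_btwn.1 hlt
  have hq : (0 : ℝ) < q := Real.toNNReal_pos.1 (ENNReal.coe_pos.1 (bot_le.trans_lt hzq))
  exact hx q (by exact_mod_cast hq) ⟨hqx, z, hzq.le, hz⟩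

end Equilibrium

/-- Theorem `thm:exist-abstract`: under (A5)–(A8), for every probability measure `m₀` on `Y`,
the potential `𝓙` admits a minimizer in `𝓟_{m₀}(X)`; if moreover `H` is symmetric, the
non-atomic game admits an equilibrium. -/
theorem exists_minimizer_and_equilibrium
    {X Y : Type*}
    [TopologicalSpace X] [PolishSpace X] [MeasurableSpace X] [BorelSpace X]
    [TopologicalSpace Y] [PolishSpace Y] [MeasurableSpace Y] [BorelSpace Y]
    (π : X → Y) (hπ : Continuous π)
    (L : X → ℝ≥0∞) (hL : LowerSemicontinuous L)
    (H : X → X → ℝ≥0∞) (hH : Measurable (Function.uncurry H))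
    (hA5 : LowerSemicontinuous fun p : X × X => Jcost L H p.1 p.2)
    (κ : ℝ) (hκpos : 0 < κ)
    (hA6 : ∀ y : Y, ∃ x : X, π x = y ∧ L x ≤ ENNReal.ofReal κ)
    (hA7 : ∀ c : ℝ, 0 < c → IsCompact {x : X | L x ≤ ENNReal.ofReal c})
    (C : ℝ) (hCpos : 0 < C)
    (hA8 : ∀ x x' : X, H x x' ≤ ENNReal.ofReal C * (L x + L x' + 1))
    (m₀ : Measure Y) [IsProbabilityMeasure m₀] :
    (∃ Q : Measure X, IsProbabilityMeasure Q ∧ Q.map π = m₀ ∧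
      ∀ Q' : Measure X, IsProbabilityMeasure Q' → Q'.map π = m₀ →
        Jpot L H Q ≤ Jpot L H Q') ∧
    ((∀ x x' : X, H x x' = H x' x) →
      ∃ Q : Measure X, IsProbabilityMeasure Q ∧ Q.map π = m₀ ∧
        (∫⁻ x, Fcost L H x Q ∂Q) ≠ ⊤ ∧
        ∀ᵐ x ∂Q, Fcost L H x Q = ⨅ (z : X) (_ : π z = π x), Fcost L H z Q) := by
  have hLm : Measurable L := hL.measurable
  obtain ⟨y₀⟩ : Nonempty Y := nonempty_of_isProbabilityMeasure m₀
  obtain ⟨x₀, -, hx₀⟩ := hA6 y₀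
  have himage : π '' {x | L x ≤ ENNReal.ofReal κ} = univ :=
    eq_univ_of_forall fun y ↦ let ⟨x, hxy, hxL⟩ := hA6 y; ⟨x, hxL, hxy⟩
  obtain ⟨P, hPπ, hPK⟩ := exists_measure_map_eq_of_isCompact (m := m₀) hπ (hA7 κ hκpos) ⟨x₀, hx₀⟩
    (by simp [himage])
  have hPprob : IsProbabilityMeasure P := by
    have : IsProbabilityMeasure (P.map π) := hPπ ▸ inferInstance
    exact Measure.isProbabilityMeasure_of_map π
  have hPL : ∫⁻ x, L x ∂P ≠ ⊤ := by
    refine ne_top_of_le_ne_top ?_ (lintegral_mono_ae hPK)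
    simp
  have hPJ : Jpot L H P ≠ ⊤ := by
    have := lintegral_lintegral_ne_top ENNReal.ofReal_ne_top hLm hA8 hPL hPL
    rw [Jpot_eq hLm hH]
    finiteness
  obtain ⟨Q, hQprob, hQπ, hQmin⟩ := exists_Jpot_minimizer hπ hLm hH hA5 hA7 hPπ hPJ
  refine ⟨⟨Q, hQprob, hQπ, hQmin⟩, fun hsymm ↦ ⟨Q, hQprob, hQπ, ?_⟩⟩
  have hQL : ∫⁻ x, L x ∂Q ≠ ⊤ := by
    refine ne_top_of_le_ne_top hPJ (le_trans ?_ (hQmin P hPprob hPπ))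
    rw [Jpot_eq hLm hH]
    exact (le_mul_of_one_le_left zero_le one_le_two).trans le_self_add
  have hFfin : ∫⁻ x, Fcost L H x Q ∂Q ≠ ⊤ := by
    have := lintegral_lintegral_ne_top ENNReal.ofReal_ne_top hLm hA8 hQL hQL
    rw [lintegral_Fcost hLm]
    finiteness
  refine ⟨hFfin, ae_Fcost_eq_iInf hπ hLm hA5 hA7 hQπ hFfin fun R hRprob hRπ hRL ↦ ?_⟩
  refine lintegral_Fcost_le_of_forall_Jpot_le ENNReal.ofReal_ne_top hLm hH hA8 hsymm hQL hRL
    fun a b hab ↦ hQmin _ ⟨by simp [hab]⟩ ?_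
  rw [Measure.map_add _ _ hπ.measurable, Measure.map_smul, Measure.map_smul, hQπ, hRπ,
    ← add_smul, hab, one_smul]
end
end

section
/- Assume (H1), (H2), (H3), and (H5). Then the function L : Γ → [0,+∞] defined by L(γ) = ∫₀^∞ ℓ(t,γ(t),γ̇(t)) dt + Ψ(τ(γ)) if γ is absolutely continuous and L(γ) = +∞ otherwise, is lower semicontinuous on Γ. -/
open MeasureTheory Filter Topology Set
open scoped ENNReal NNReal

noncomputable section

/-- Euclidean space `ℝ^d`. -/
abbrev EucSp (d : ℕ) := EuclideanSpace ℝ (Fin d)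

/-- The space `Γ = C(ℝ₊, Ω̄)` of continuous curves with values in `closure Ω`, endowed with
the topology of uniform convergence on compact time intervals (the compact-open topology). -/
abbrev CurveSp {d : ℕ} (Ω : Set (EucSp d)) :=
  {γ : C(ℝ≥0, EucSp d) // ∀ t : ℝ≥0, γ t ∈ closure Ω}

variable {d : ℕ}

/-- `γ` is absolutely continuous with (locally integrable) velocity `g`. -/
def HasVel {Ω : Set (EucSp d)} (γ : CurveSp Ω) (g : ℝ → EucSp d) : Prop :=
  (∀ T : ℝ, IntegrableOn g (Set.Icc 0 T) volume) ∧
    ∀ t : ℝ≥0, γ.1 t = γ.1 0 + ∫ s in Set.Ioc (0 : ℝ) (t : ℝ), g s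

/-- The first exit time `τ(γ) = inf {t ≥ 0 | γ(t) ∈ Ξ}`, with value `+∞` if `γ` never
reaches `Ξ`. -/
def exitT {Ω : Set (EucSp d)} (Ξ : Set (EucSp d)) (γ : CurveSp Ω) : ℝ≥0∞ :=
  ⨅ (t : ℝ≥0) (_ : γ.1 t ∈ Ξ), (t : ℝ≥0∞)

/-- The extension of a nondecreasing `Ψ : ℝ₊ → ℝ₊` to `[0,+∞]`: for finite `T` it coincides
with `Ψ(T)` (as `Ψ` is nondecreasing), and `Ψ(+∞) = sup Ψ`. -/
def PsiExt (Ψ : ℝ → ℝ) (T : ℝ≥0∞) : ℝ≥0∞ :=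
  ⨆ (t : ℝ≥0) (_ : (t : ℝ≥0∞) ≤ T), ENNReal.ofReal (Ψ (t : ℝ))

/-- The individual cost `L(γ) = ∫₀^∞ ℓ(t,γ(t),γ̇(t)) dt + Ψ(τ(γ))` if `γ` is absolutely
continuous, and `L(γ) = +∞` otherwise (the infimum over an empty family is `+∞`; any two
velocities of `γ` agree a.e., so the infimum is the common value of the integral). -/
def Lcost {Ω : Set (EucSp d)} (ℓ : ℝ → EucSp d → EucSp d → ℝ) (Ψ : ℝ → ℝ)
    (Ξ : Set (EucSp d)) (γ : CurveSp Ω) : ℝ≥0∞ :=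
  (⨅ (g : ℝ → EucSp d) (_ : HasVel γ g),
    ∫⁻ t in Set.Ioi (0 : ℝ), ENNReal.ofReal (ℓ t (γ.1 t.toNNReal) (g t))) +
  PsiExt Ψ (exitT Ξ γ)

/-- The raw pairwise interaction cost
`∫₀^{τ(γ) ∧ τ(γ̃)} h(t,γ(t),γ̃(t),γ̇(t),γ̃̇(t)) dt`, equal to `+∞` when one of the curves is
not absolutely continuous. -/
def interCost {Ω : Set (EucSp d)}
    (h : ℝ → EucSp d → EucSp d → EucSp d → EucSp d → ℝ)
    (Ξ : Set (EucSp d)) (γ γ' : CurveSp Ω) : ℝ≥0∞ :=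
  ⨅ (g : ℝ → EucSp d) (_ : HasVel γ g) (g' : ℝ → EucSp d) (_ : HasVel γ' g'),
    ∫⁻ t in {t : ℝ | 0 < t ∧ ENNReal.ofReal t < min (exitT Ξ γ) (exitT Ξ γ')},
      ENNReal.ofReal (h t (γ.1 t.toNNReal) (γ'.1 t.toNNReal) (g t) (g' t))

/-- The interaction cost `H(γ,γ̃)`, equal to the raw interaction cost when
`L(γ) < +∞` and `L(γ̃) < +∞`, and to `+∞` otherwise. -/
def Hcost {Ω : Set (EucSp d)} (ℓ : ℝ → EucSp d → EucSp d → ℝ) (Ψ : ℝ → ℝ)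
    (h : ℝ → EucSp d → EucSp d → EucSp d → EucSp d → ℝ)
    (Ξ : Set (EucSp d)) (γ γ' : CurveSp Ω) : ℝ≥0∞ :=
  if Lcost ℓ Ψ Ξ γ ≠ ⊤ ∧ Lcost ℓ Ψ Ξ γ' ≠ ⊤ then interCost h Ξ γ γ' else ⊤

instance {Ω : Set (EucSp d)} : MeasurableSpace (CurveSp Ω) := borel _
instance {Ω : Set (EucSp d)} : BorelSpace (CurveSp Ω) := ⟨rfl⟩

/-- The total cost `F(γ,Q)` from the mean field game, with the conventions of the paper:
`F(γ,Q) = +∞` if `γ` is not absolutely continuous, if `Q` gives positive measure to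
non-absolutely-continuous curves, or if the inner interaction integral is not `Q`-integrable. -/
def F1cost {Ω : Set (EucSp d)} (ℓ : ℝ → EucSp d → EucSp d → ℝ) (Ψ : ℝ → ℝ)
    (h : ℝ → EucSp d → EucSp d → EucSp d → EucSp d → ℝ)
    (Ξ : Set (EucSp d)) (γ : CurveSp Ω) (Q : Measure (CurveSp Ω)) : ℝ≥0∞ :=
  if Q {γ' : CurveSp Ω | ¬ ∃ g : ℝ → EucSp d, HasVel γ' g} = 0 then
    Lcost ℓ Ψ Ξ γ + ∫⁻ γ', interCost h Ξ γ γ' ∂Q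
  else ⊤

/-- The total cost `F(γ,Q) = L(γ) + ∫ H(γ,·) dQ` of the associated abstract non-atomic game. -/
def F2cost {Ω : Set (EucSp d)} (ℓ : ℝ → EucSp d → EucSp d → ℝ) (Ψ : ℝ → ℝ)
    (h : ℝ → EucSp d → EucSp d → EucSp d → EucSp d → ℝ)
    (Ξ : Set (EucSp d)) (γ : CurveSp Ω) (Q : Measure (CurveSp Ω)) : ℝ≥0∞ :=
  Lcost ℓ Ψ Ξ γ + ∫⁻ γ', Hcost ℓ Ψ h Ξ γ γ' ∂Q

/-- The geodesic (intrinsic) distance in `S`: the infimum of the lengths (total variations)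
of continuous paths in `S` joining `x` to `y`. -/
def geoDist {d : ℕ} (S : Set (EucSp d)) (x y : EucSp d) : ℝ≥0∞ :=
  ⨅ (f : ℝ → EucSp d) (_ : ContinuousOn f (Set.Icc 0 1))
    (_ : ∀ t ∈ Set.Icc (0 : ℝ) 1, f t ∈ S) (_ : f 0 = x) (_ : f 1 = y),
    eVariationOn f (Set.Icc 0 1)



/-- The strictly convex function `p ↦ √(1 + ‖p‖²)`. -/
def sqrtOneAdd {E : Type*} [NormedAddCommGroup E] (p : E) : ℝ := √(1 + ‖p‖ ^ 2)

/-- The gap in the midpoint convexity inequality for `sqrtOneAdd`. -/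
def midGap {E : Type*} [NormedAddCommGroup E] [InnerProductSpace ℝ E] (p q : E) : ℝ :=
  sqrtOneAdd p + sqrtOneAdd q - 2 * sqrtOneAdd (midpoint ℝ p q)

section Normed

variable {E : Type*} [NormedAddCommGroup E]

lemma sqrtOneAdd_nonneg (p : E) : 0 ≤ sqrtOneAdd p := Real.sqrt_nonneg _

lemma sqrtOneAdd_sq (p : E) : sqrtOneAdd p ^ 2 = 1 + ‖p‖ ^ 2 :=
  Real.sq_sqrt (by positivity)

lemma sqrtOneAdd_le (p : E) : sqrtOneAdd p ≤ 1 + ‖p‖ := by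
  refine Real.sqrt_le_iff.2 ⟨by positivity, ?_⟩
  nlinarith [norm_nonneg p]

lemma continuous_sqrtOneAdd : Continuous (sqrtOneAdd : E → ℝ) := by
  unfold sqrtOneAdd
  fun_prop

end Normed

section InnerProduct

variable {E : Type*} [NormedAddCommGroup E] [InnerProductSpace ℝ E]

lemma norm_sub_sq_le_midGap {S : ℝ} {p q : E} (hp : sqrtOneAdd p ≤ S) (hq : sqrtOneAdd q ≤ S) :
    ‖p - q‖ ^ 2 ≤ 4 * S ^ 3 * midGap p q := by
  have hm : (2 * sqrtOneAdd (midpoint ℝ p q)) ^ 2 = 4 + ‖p + q‖ ^ 2 := by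
    rw [mul_pow, sqrtOneAdd_sq, midpoint_eq_smul_add, norm_smul, mul_pow]
    norm_num
    ring
  have hA := sqrtOneAdd_sq p
  have hB := sqrtOneAdd_sq q
  have hA0 := sqrtOneAdd_nonneg p
  have hB0 := sqrtOneAdd_nonneg q
  have hM0 := sqrtOneAdd_nonneg (midpoint ℝ p q)
  have hadd := norm_add_sq_real p q
  have hsub := norm_sub_sq_real p q
  have hCS : inner ℝ p q ^ 2 ≤ ‖p‖ ^ 2 * ‖q‖ ^ 2 := by
    rw [← mul_pow]
    exact sq_le_sq' (by linarith [neg_le_of_abs_le (abs_real_inner_le_norm p q)])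
      (real_inner_le_norm p q)
  unfold midGap
  set A := sqrtOneAdd p
  set B := sqrtOneAdd q
  set M := sqrtOneAdd (midpoint ℝ p q)
  set I := inner ℝ p q
  have hprod : (A * B) ^ 2 - (1 + I) ^ 2 = ‖p - q‖ ^ 2 + (‖p‖ ^ 2 * ‖q‖ ^ 2 - I ^ 2) := by
    rw [mul_pow, hA, hB, hsub]; ring
  have hAB : |1 + I| ≤ A * B := by
    refine abs_le_of_sq_le_sq ?_ (by positivity)
    nlinarith [sq_nonneg ‖p - q‖]
  have hAB1 := le_of_abs_le hAB
  have hS : 0 ≤ S := hA0.trans hp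
  have hABS : A * B ≤ S ^ 2 := by rw [sq]; exact mul_le_mul hp hq hB0 hS
  have h1 : ‖p - q‖ ^ 2 ≤ (A * B - (1 + I)) * (2 * S ^ 2) := by
    calc ‖p - q‖ ^ 2 ≤ (A * B - (1 + I)) * (A * B + (1 + I)) := by nlinarith
      _ ≤ _ := by
        apply mul_le_mul_of_nonneg_left _ (by linarith)
        linarith
  have h2 : (A + B - 2 * M) * (A + B + 2 * M) = 2 * (A * B - (1 + I)) := by
    linear_combination hA + hB - hm - hadd
  have hMAB : 2 * M ≤ A + B := by
    refine le_of_sq_le_sq ?_ (by positivity)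
    nlinarith
  have h3 : 2 * (A * B - (1 + I)) ≤ (A + B - 2 * M) * (4 * S) := by
    rw [← h2]
    apply mul_le_mul_of_nonneg_left _ (by linarith)
    linarith
  calc ‖p - q‖ ^ 2 ≤ (2 * (A * B - (1 + I))) * S ^ 2 := by linarith
    _ ≤ ((A + B - 2 * M) * (4 * S)) * S ^ 2 := by gcongr
    _ = _ := by ring

lemma midGap_nonneg (p q : E) : 0 ≤ midGap p q := by
  set S := 1 + sqrtOneAdd p + sqrtOneAdd q
  have hp := sqrtOneAdd_nonneg p
  have hq := sqrtOneAdd_nonneg q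
  have h := norm_sub_sq_le_midGap (S := S) (p := p) (q := q) (by grind) (by grind)
  have hS : 0 < 4 * S ^ 3 := by positivity
  exact nonneg_of_mul_nonneg_right ((sq_nonneg _).trans h) hS

lemma norm_sub_le_midGap_add {θ R η : ℝ} (hθ : 1 < θ) (hR : 0 < R) (hη : 0 < η) (p q : E) :
    ‖p - q‖ ≤ η + 4 * (1 + R) ^ 3 / η * midGap p q +
      2 / R ^ (θ - 1) * (‖p‖ ^ θ + ‖q‖ ^ θ) := by
  have hD := midGap_nonneg p q
  have hRθ : 0 < R ^ (θ - 1) := Real.rpow_pos_of_pos hR _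
  have hlarge : ∀ r : ℝ, R < r → r ≤ r ^ θ / R ^ (θ - 1) := fun r hr ↦ by
    have hr0 : 0 < r := hR.trans hr
    rw [le_div_iff₀ hRθ]
    calc r * R ^ (θ - 1) ≤ r * r ^ (θ - 1) := by gcongr
      _ = r ^ θ := by rw [Real.rpow_sub_one hr0.ne']; field_simp
  have hle : ∀ r : ℝ, R < r → (r = ‖p‖ ∨ r = ‖q‖) → ‖p‖ ≤ r → ‖q‖ ≤ r →
      ‖p - q‖ ≤ 2 / R ^ (θ - 1) * (‖p‖ ^ θ + ‖q‖ ^ θ) := by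
    intro r hr hpq hp hq
    calc ‖p - q‖ ≤ 2 * r := by linarith [norm_sub_le p q]
      _ ≤ 2 * (r ^ θ / R ^ (θ - 1)) := by gcongr; exact hlarge r hr
      _ = 2 / R ^ (θ - 1) * r ^ θ := by ring
      _ ≤ _ := by
        gcongr
        have h1 : 0 ≤ ‖p‖ ^ θ := by positivity
        have h2 : 0 ≤ ‖q‖ ^ θ := by positivity
        rcases hpq with rfl | rfl <;> linarith
  have h0 : 0 ≤ 4 * (1 + R) ^ 3 / η * midGap p q := by positivity
  by_cases hsmall : ‖p‖ ≤ R ∧ ‖q‖ ≤ R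
  · have h := norm_sub_sq_le_midGap (S := 1 + R) ((sqrtOneAdd_le p).trans (by linarith))
      ((sqrtOneAdd_le q).trans (by linarith [hsmall.2]))
    have h1 : ‖p - q‖ ≤ η + ‖p - q‖ ^ 2 / η := by
      rcases le_total ‖p - q‖ η with h2 | h2
      · have : 0 ≤ ‖p - q‖ ^ 2 / η := by positivity
        linarith
      · have : ‖p - q‖ ≤ ‖p - q‖ ^ 2 / η := by
          rw [le_div_iff₀ hη, sq]; gcongr
        linarith
    have h2 : ‖p - q‖ ^ 2 / η ≤ 4 * (1 + R) ^ 3 / η * midGap p q := by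
      rw [div_mul_eq_mul_div]; gcongr
    have h3 : 0 ≤ 2 / R ^ (θ - 1) * (‖p‖ ^ θ + ‖q‖ ^ θ) := by positivity
    linarith
  · rcases le_total ‖p‖ ‖q‖ with hpq | hpq
    · have := hle ‖q‖ (by by_contra! h; exact hsmall ⟨hpq.trans h, h⟩) (.inr rfl) hpq le_rfl
      linarith
    · have := hle ‖p‖ (by by_contra! h; exact hsmall ⟨h, hpq.trans h⟩) (.inl rfl) le_rfl hpq
      linarith

end InnerProduct

section ForwardConvex

variable {X E : Type*} [MeasurableSpace X] {ν : Measure X} [IsFiniteMeasure ν]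
  [NormedAddCommGroup E] {θ : ℝ}

lemma norm_le_one_add_rpow (hθ : 1 < θ) (p : E) : ‖p‖ ≤ 1 + ‖p‖ ^ θ := by
  rcases le_total ‖p‖ 1 with h | h
  · have : 0 ≤ ‖p‖ ^ θ := by positivity
    linarith
  · have := Real.rpow_le_rpow_of_exponent_le h hθ.le
    rw [Real.rpow_one] at this
    linarith

lemma integrable_of_integrable_norm_rpow (hθ : 1 < θ) {G : X → E}
    (hG : AEStronglyMeasurable G ν) (hG' : Integrable (fun x ↦ ‖G x‖ ^ θ) ν) :
    Integrable G ν := by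
  refine Integrable.mono' ((integrable_const (1 : ℝ)).add hG') hG ?_
  exact Eventually.of_forall fun x ↦ norm_le_one_add_rpow hθ (G x)

lemma integrable_sqrtOneAdd {G : X → E} (hG : Integrable G ν) :
    Integrable (fun x ↦ sqrtOneAdd (G x)) ν := by
  refine Integrable.mono' ((integrable_const (1 : ℝ)).add hG.norm)
    (continuous_sqrtOneAdd.comp_aestronglyMeasurable hG.1) ?_
  refine Eventually.of_forall fun x ↦ ?_
  rw [Real.norm_of_nonneg (sqrtOneAdd_nonneg _)]
  exact sqrtOneAdd_le _

/-- In a decreasing sequence of convex sets of functions that are uniformly bounded in `L^θ`,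
`θ > 1`, one can choose elements converging in `L¹`. -/
lemma exists_tendsto_eLpNorm_of_antitone_convex [InnerProductSpace ℝ E] [CompleteSpace E]
    (hθ : 1 < θ) {K : ℕ → Set (X → E)} (hK : Antitone K) (hconv : ∀ n, Convex ℝ (K n))
    (hne : ∀ n, (K n).Nonempty) {C : ℝ}
    (hmeas : ∀ G ∈ K 0, AEStronglyMeasurable G ν)
    (hint : ∀ G ∈ K 0, Integrable (fun x ↦ ‖G x‖ ^ θ) ν)
    (hC : ∀ G ∈ K 0, ∫ x, ‖G x‖ ^ θ ∂ν ≤ C) :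
    ∃ G : ℕ → X → E, (∀ n, G n ∈ K n) ∧ ∃ g : X → E, Integrable g ν ∧
      Tendsto (fun n ↦ eLpNorm (G n - g) 1 ν) atTop (𝓝 0) := by
  have hK0 : ∀ {n G}, G ∈ K n → G ∈ K 0 := fun h ↦ hK (Nat.zero_le _) h
  have hGint : ∀ G ∈ K 0, Integrable G ν := fun G h ↦
    integrable_of_integrable_norm_rpow hθ (hmeas G h) (hint G h)
  let Φ : (X → E) → ℝ := fun G ↦ ∫ x, sqrtOneAdd (G x) ∂ν
  have hΦ0 : ∀ G, 0 ≤ Φ G := fun G ↦ integral_nonneg fun x ↦ sqrtOneAdd_nonneg _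
  have hΦB : ∀ G ∈ K 0, Φ G ≤ ∫ _, (2 : ℝ) ∂ν + C := by
    intro G hG
    calc Φ G ≤ ∫ x, ((2 : ℝ) + ‖G x‖ ^ θ) ∂ν := by
          refine integral_mono (integrable_sqrtOneAdd (hGint G hG))
            ((integrable_const _).add (hint G hG)) fun x ↦ ?_
          have h1 := sqrtOneAdd_le (G x)
          have h2 := norm_le_one_add_rpow hθ (G x)
          simp only
          linarith
      _ = ∫ _, (2 : ℝ) ∂ν + ∫ x, ‖G x‖ ^ θ ∂ν := integral_add (integrable_const _) (hint G hG)
      _ ≤ _ := by gcongr; exact hC G hG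
  have hbdd : ∀ n, BddBelow (Φ '' K n) := fun n ↦ ⟨0, by rintro _ ⟨G, -, rfl⟩; exact hΦ0 G⟩
  let a : ℕ → ℝ := fun n ↦ sInf (Φ '' K n)
  have haΦ : ∀ {n G}, G ∈ K n → a n ≤ Φ G := fun h ↦ csInf_le (hbdd _) (mem_image_of_mem _ h)
  have hamono : Monotone a := fun m n h ↦
    csInf_le_csInf (hbdd m) ((hne n).image _) (image_mono (hK h))
  have habdd : BddAbove (range a) := by
    refine ⟨∫ _, (2 : ℝ) ∂ν + C, ?_⟩
    rintro _ ⟨n, rfl⟩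
    obtain ⟨G, hG⟩ := hne n
    exact (haΦ hG).trans (hΦB G (hK0 hG))
  obtain ⟨A, hA⟩ : ∃ A, Tendsto a atTop (𝓝 A) := ⟨_, tendsto_atTop_ciSup hamono habdd⟩
  have haA : ∀ n, a n ≤ A := hamono.ge_of_tendsto hA
  have hex : ∀ n : ℕ, ∃ G ∈ K n, Φ G < a n + 1 / ((n : ℝ) + 1) := by
    intro n
    obtain ⟨_, ⟨G, hG, rfl⟩, h⟩ := exists_lt_of_csInf_lt ((hne n).image Φ)
      (show a n < a n + 1 / ((n : ℝ) + 1) by linarith [Nat.one_div_pos_of_nat (α := ℝ) (n := n)])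
    exact ⟨G, hG, h⟩
  choose G hGK hGΦ using hex
  have hGi : ∀ n, Integrable (G n) ν := fun n ↦ hGint _ (hK0 (hGK n))
  have hGθ : ∀ n, Integrable (fun x ↦ ‖G n x‖ ^ θ) ν := fun n ↦ hint _ (hK0 (hGK n))
  have hmid : ∀ N m n, N ≤ m → N ≤ n → (fun x ↦ midpoint ℝ (G m x) (G n x)) ∈ K N := by
    intro N m n hm hn
    have := (hconv N).midpoint_mem (hK hm (hGK m)) (hK hn (hGK n))
    convert this using 1
    ext x
    simp [midpoint_eq_smul_add]
  have hgapint : ∀ m n, Integrable (fun x ↦ midGap (G m x) (G n x)) ν := fun m n ↦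
    ((integrable_sqrtOneAdd (hGi m)).add (integrable_sqrtOneAdd (hGi n))).sub
      ((integrable_sqrtOneAdd (hGint _ (hmid 0 m n (by simp) (by simp)))).const_mul 2)
  have hgap : ∀ N m n, N ≤ m → N ≤ n →
      ∫ x, midGap (G m x) (G n x) ∂ν ≤ 2 * (A - a N) + 2 * (1 / ((N : ℝ) + 1)) := by
    intro N m n hm hn
    have hmidint := integrable_sqrtOneAdd (hGint _ (hK0 (hmid N m n hm hn)))
    have hsum : Integrable (fun x ↦ sqrtOneAdd (G m x) + sqrtOneAdd (G n x)) ν :=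
      (integrable_sqrtOneAdd (hGi m)).add (integrable_sqrtOneAdd (hGi n))
    have h1 : ∫ x, midGap (G m x) (G n x) ∂ν =
        Φ (G m) + Φ (G n) - 2 * Φ (fun x ↦ midpoint ℝ (G m x) (G n x)) := by
      unfold midGap
      rw [integral_sub hsum (hmidint.const_mul 2), integral_add (integrable_sqrtOneAdd (hGi m))
        (integrable_sqrtOneAdd (hGi n)), integral_const_mul]
    have h2 := haΦ (hmid N m n hm hn)
    have h3 := Nat.one_div_le_one_div (α := ℝ) hm
    have h4 := Nat.one_div_le_one_div (α := ℝ) hn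
    linarith [hGΦ m, hGΦ n, haA m, haA n]
  have hdist : ∀ R η : ℝ, 0 < R → 0 < η → ∀ m n, ∫ x, ‖G m x - G n x‖ ∂ν ≤
      ν.real univ * η + 4 * (1 + R) ^ 3 / η * ∫ x, midGap (G m x) (G n x) ∂ν +
        2 / R ^ (θ - 1) * (C + C) := by
    intro R η hR hη m n
    have hi1 : Integrable (fun x ↦ η + 4 * (1 + R) ^ 3 / η * midGap (G m x) (G n x)) ν :=
      (integrable_const η).add ((hgapint m n).const_mul (4 * (1 + R) ^ 3 / η))
    have hi2 : Integrable (fun x ↦ 2 / R ^ (θ - 1) * (‖G m x‖ ^ θ + ‖G n x‖ ^ θ)) ν :=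
      ((hGθ m).add (hGθ n)).const_mul (2 / R ^ (θ - 1))
    calc ∫ x, ‖G m x - G n x‖ ∂ν ≤ ∫ x, (η + 4 * (1 + R) ^ 3 / η * midGap (G m x) (G n x) +
          2 / R ^ (θ - 1) * (‖G m x‖ ^ θ + ‖G n x‖ ^ θ)) ∂ν :=
          integral_mono ((hGi m).sub (hGi n)).norm (hi1.add hi2)
            fun x ↦ norm_sub_le_midGap_add hθ hR hη _ _
      _ = ν.real univ * η + 4 * (1 + R) ^ 3 / η * ∫ x, midGap (G m x) (G n x) ∂ν +
          2 / R ^ (θ - 1) * (∫ x, ‖G m x‖ ^ θ ∂ν + ∫ x, ‖G n x‖ ^ θ ∂ν) := by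
        rw [integral_add hi1 hi2, integral_add (integrable_const η) ((hgapint m n).const_mul _),
          integral_const_mul, integral_const_mul, integral_add (hGθ m) (hGθ n), integral_const,
          smul_eq_mul]
      _ ≤ _ := by
        gcongr
        · exact hC _ (hK0 (hGK m))
        · exact hC _ (hK0 (hGK n))
  have hsmall : ∀ ε > 0, ∃ N, ∀ m ≥ N, ∀ n ≥ N, ∫ x, ‖G m x - G n x‖ ∂ν < ε := by
    intro ε hε
    obtain ⟨R, hR, hR0⟩ : ∃ R : ℝ, 2 / R ^ (θ - 1) * (C + C) < ε / 3 ∧ 0 < R := by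
      have : Tendsto (fun R : ℝ ↦ 2 / R ^ (θ - 1) * (C + C)) atTop (𝓝 (0 * (C + C))) :=
        ((tendsto_rpow_atTop (by linarith)).const_div_atTop 2).mul_const _
      rw [zero_mul] at this
      exact ((this.eventually_lt_const (by positivity)).and (eventually_gt_atTop 0)).exists
    obtain ⟨η, hη, hη0⟩ : ∃ η : ℝ, ν.real univ * η < ε / 3 ∧ 0 < η := by
      have : Tendsto (fun η : ℝ ↦ ν.real univ * η) (𝓝[>] 0) (𝓝 (ν.real univ * 0)) :=
        (tendsto_nhdsWithin_of_tendsto_nhds tendsto_id).const_mul _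
      rw [mul_zero] at this
      exact ((this.eventually_lt_const (by positivity)).and self_mem_nhdsWithin).exists
    obtain ⟨N, hN⟩ : ∃ N : ℕ, 4 * (1 + R) ^ 3 / η *
        (2 * (A - a N) + 2 * (1 / ((N : ℝ) + 1))) < ε / 3 := by
      have h : Tendsto (fun N : ℕ ↦ 4 * (1 + R) ^ 3 / η *
          (2 * (A - a N) + 2 * (1 / ((N : ℝ) + 1)))) atTop
          (𝓝 (4 * (1 + R) ^ 3 / η * (2 * (A - A) + 2 * 0))) :=
        (((hA.const_sub A).const_mul 2).add
          (tendsto_one_div_add_atTop_nhds_zero_nat.const_mul 2)).const_mul _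
      simp only [sub_self, mul_zero, add_zero] at h
      exact (h.eventually_lt_const (by positivity)).exists
    refine ⟨N, fun m hm n hn ↦ (hdist R η hR0 hη0 m n).trans_lt ?_⟩
    have : 4 * (1 + R) ^ 3 / η * ∫ x, midGap (G m x) (G n x) ∂ν ≤
        4 * (1 + R) ^ 3 / η * (2 * (A - a N) + 2 * (1 / ((N : ℝ) + 1))) := by
      gcongr
      exact hgap N m n hm hn
    linarith
  have hcau : CauchySeq fun n ↦ (hGi n).toL1 (G n) := by
    refine Metric.cauchySeq_iff.2 fun ε hε ↦ ?_
    obtain ⟨N, hN⟩ := hsmall ε hε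
    refine ⟨N, fun m hm n hn ↦ ?_⟩
    rw [dist_eq_norm, ← Integrable.toL1_sub, L1.norm_of_fun_eq_integral_norm]
    exact hN m hm n hn
  obtain ⟨g, hg⟩ := cauchySeq_tendsto_of_complete hcau
  refine ⟨G, hGK, g, L1.integrable_coeFn g, ?_⟩
  rw [tendsto_iff_edist_tendsto_0] at hg
  refine hg.congr fun n ↦ ?_
  rw [Lp.edist_def]
  exact eLpNorm_congr_ae ((hGi n).coeFn_toL1.sub (ae_eq_refl _))

end ForwardConvex

section Carathéodory

variable {E : Type*} [NormedAddCommGroup E]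

/-- Composition of a Carathéodory function with measurable functions. -/
lemma aemeasurable_caratheodory_comp {X Y : Type*} [MeasurableSpace X] {μ : Measure X}
    [TopologicalSpace Y] [TopologicalSpace.MetrizableSpace Y] [SecondCountableTopology Y]
    [MeasurableSpace Y] [OpensMeasurableSpace Y] {f : X → Y → ℝ} (hmeas : ∀ y, Measurable fun x ↦ f x y)
    (hcont : ∀ᵐ x ∂μ, Continuous (f x)) {u : X → Y} (hu : AEMeasurable u μ) :
    AEMeasurable (fun x ↦ f x (u x)) μ := by
  obtain ⟨S, hS, hSm, hScont⟩ := hcont.exists_measurable_mem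
  have h : Measurable (Function.uncurry fun (y : Y) (x : X) ↦ S.indicator (fun x ↦ f x y) x) := by
    refine measurable_uncurry_of_continuous_of_measurable (fun x ↦ ?_)
      fun y ↦ (hmeas y).indicator hSm
    by_cases hx : x ∈ S
    · simpa [hx] using hScont x hx
    · simpa [hx] using continuous_const
  refine (h.comp_aemeasurable (hu.prodMk aemeasurable_id)).congr ?_
  filter_upwards [hS] with x hx
  simp only [Function.comp_apply, Function.uncurry, id]
  exact indicator_of_mem hx _

/-- A coercive function that is continuous on `C ×ˢ univ` and convex in its second variable admits,
near any `x ∈ C`, an affine minorant in the second variable that is almost exact at `(x, p)`. -/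
lemma exists_affine_minorant_near [NormedSpace ℝ E] [ProperSpace E] {Z : Type*}
    [PseudoMetricSpace Z]
    {C : Set Z} (hC : IsCompact C) {f : Z → E → ℝ} {α θ : ℝ} (hα : 0 < α) (hθ : 1 < θ)
    (hcont : ContinuousOn (fun q : Z × E ↦ f q.1 q.2) (C ×ˢ univ)) {x : Z} (hx : x ∈ C)
    (hconv : ConvexOn ℝ univ (f x)) (hlb : ∀ y ∈ C, ∀ p, α * ‖p‖ ^ θ ≤ f y p)
    (p : E) {ε : ℝ} (hε : 0 < ε) :
    ∃ (A : E →L[ℝ] ℝ) (b : ℝ), A p + b = f x p - ε ∧ ∀ᶠ y in 𝓝[C] x, ∀ q, A q + b ≤ f y q := by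
  have hfx : Continuous (f x) := by
    have : ContinuousOn (fun q ↦ f x q) univ :=
      hcont.comp (f := fun q : E ↦ (x, q)) (by fun_prop) fun q _ ↦ ⟨hx, mem_univ q⟩
    exact continuousOn_univ.1 this
  obtain ⟨A, c, hle, hA⟩ := hconv.exists_affine_le_of_lt (𝕜 := ℝ) (mem_univ p)
    (show f x p - ε / 2 < f x p by linarith) isClosed_univ
    (hfx.lowerSemicontinuous.lowerSemicontinuousOn _)
  replace hle : ∀ q, A q + c ≤ f x q := fun q ↦ hle ⟨q, mem_univ q⟩
  replace hA : A p + c = f x p - ε / 2 := hA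
  refine ⟨A, c - ε / 2, by linarith, ?_⟩
  obtain ⟨R, hR⟩ : ∃ R : ℝ, ∀ r > R, ‖A‖ * r + c ≤ α * r ^ θ := by
    have h1 : Tendsto (fun r : ℝ ↦ α * r ^ (θ - 1)) atTop atTop :=
      (tendsto_rpow_atTop (by linarith)).const_mul_atTop hα
    have h2 := (h1.eventually_ge_atTop (‖A‖ + |c|)).and (eventually_ge_atTop 1)
    obtain ⟨R, hR⟩ := eventually_atTop.1 h2
    refine ⟨R, fun r hr ↦ ?_⟩
    obtain ⟨h3, h4⟩ := hR r hr.le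
    have h5 : α * r ^ θ = (α * r ^ (θ - 1)) * r := by
      rw [Real.rpow_sub_one (by positivity)]; field_simp
    rw [h5]
    have h6 : |c| ≤ |c| * r := le_mul_of_one_le_right (abs_nonneg c) h4
    calc ‖A‖ * r + c ≤ (‖A‖ + |c|) * r := by linarith [le_abs_self c]
      _ ≤ _ := by gcongr
  have hunif := (hC.prod (isCompact_closedBall (0 : E) R)).uniformContinuousOn_of_continuous
    (hcont.mono (prod_mono_right (subset_univ _)))
  obtain ⟨δ, hδ, hunif⟩ := Metric.uniformContinuousOn_iff.1 hunif (ε / 2) (by linarith)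
  filter_upwards [self_mem_nhdsWithin, mem_nhdsWithin_of_mem_nhds (Metric.ball_mem_nhds x hδ)]
    with y hyC hy q
  by_cases hq : ‖q‖ ≤ R
  · have hq' : q ∈ Metric.closedBall (0 : E) R := by simpa using hq
    have := hunif (x, q) ⟨hx, hq'⟩ (y, q) ⟨hyC, hq'⟩ (by
      rw [Prod.dist_eq, dist_self, max_eq_left dist_nonneg, dist_comm]; exact hy)
    rw [Real.dist_eq] at this
    linarith [hle q, le_of_abs_le this.le]
  · have h1 := hR ‖q‖ (not_le.1 hq)
    have h2 := (le_abs_self _).trans (A.le_opNorm q)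
    linarith [hlb y hyC q]

end Carathéodory

section TerminalCost

lemma eventually_le_exitT {Ω Ξ : Set (EucSp d)} (hΞ : IsClosed Ξ) {γ : CurveSp Ω} {s : ℝ≥0}
    (hs : (s : ℝ≥0∞) < exitT Ξ γ) : ∀ᶠ γ' in 𝓝 γ, (s : ℝ≥0∞) ≤ exitT Ξ γ' := by
  have hmaps : MapsTo γ.1 (Iic s) Ξᶜ := fun r hr hmem ↦
    (hs.trans_le (iInf₂_le r hmem)).not_ge (by exact_mod_cast hr)
  have hcomp : IsCompact (Iic s) := by
    rw [← Icc_bot]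
    exact isCompact_Icc
  filter_upwards [continuous_subtype_val.continuousAt.eventually
    (ContinuousMap.eventually_mapsTo hcomp hΞ.isOpen_compl hmaps)] with γ' h
  refine le_iInf₂ fun r hr ↦ ?_
  by_contra! hlt
  exact h (show r ∈ Iic s from (ENNReal.coe_lt_coe.1 hlt).le) hr

lemma lowerSemicontinuous_psiExt_exitT {Ω Ξ : Set (EucSp d)} (hΞ : IsClosed Ξ) {Ψ : ℝ → ℝ}
    (hΨ : LowerSemicontinuousOn Ψ (Ici 0)) :
    LowerSemicontinuous fun γ : CurveSp Ω ↦ PsiExt Ψ (exitT Ξ γ) := by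
  intro γ y hy
  obtain ⟨t, ht⟩ := lt_iSup_iff.1 hy
  obtain ⟨htT, hyt⟩ := lt_iSup_iff.1 ht
  have hy' : y.toReal < Ψ t := ENNReal.toReal_lt_of_lt_ofReal hyt
  have hytop : y ≠ ⊤ := hyt.ne_top
  rcases eq_or_ne t 0 with rfl | ht0
  · refine Eventually.of_forall fun γ' ↦ hyt.trans_le ?_
    exact le_iSup₂_of_le 0 (by simp) le_rfl
  · obtain ⟨s, hst, hys⟩ : ∃ s : ℝ≥0, s < t ∧ y.toReal < Ψ s := by
      have h1 : ∀ᶠ s : ℝ≥0 in 𝓝 t, y.toReal < Ψ s := by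
        have h := hΨ t t.2 _ hy'
        have hc : Tendsto (fun s : ℝ≥0 ↦ (s : ℝ)) (𝓝 t) (𝓝[Ici 0] (t : ℝ)) :=
          tendsto_nhdsWithin_iff.2 ⟨NNReal.continuous_coe.continuousAt,
            Eventually.of_forall fun s ↦ s.2⟩
        exact hc.eventually h
      have : (𝓝[<] t).NeBot := nhdsLT_neBot_of_exists_lt ⟨0, pos_iff_ne_zero.2 ht0⟩
      obtain ⟨s, h2, h3⟩ := ((h1.filter_mono nhdsWithin_le_nhds).and
        (self_mem_nhdsWithin (s := Iio t))).exists
      exact ⟨s, h3, h2⟩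
    have hlt : (s : ℝ≥0∞) < exitT Ξ γ := (ENNReal.coe_lt_coe.2 hst).trans_le htT
    filter_upwards [eventually_le_exitT hΞ hlt] with γ' h
    exact ((ENNReal.lt_ofReal_iff_toReal_lt hytop).2 hys).trans_le
      (le_iSup₂ (f := fun (t : ℝ≥0) (_ : (t : ℝ≥0∞) ≤ exitT Ξ γ') ↦ ENNReal.ofReal (Ψ t)) s h)

end TerminalCost

section RunningCost

/-- There is a finite measure with the same null sets as Lebesgue measure on the half-line that
dominates, up to a constant, Lebesgue measure on each bounded interval. -/
lemma exists_isFiniteMeasure_halfLine : ∃ ν : Measure ℝ, IsFiniteMeasure ν ∧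
    ν ≤ volume.restrict (Ioi 0) ∧ volume.restrict (Ioi 0) ≪ ν ∧
      ∀ T : ℝ, volume.restrict (Ioc 0 T) ≤ ENNReal.ofReal (Real.exp T) • ν := by
  have hm : Measurable fun t : ℝ ↦ ENNReal.ofReal (Real.exp (-t)) := by fun_prop
  refine ⟨(volume.restrict (Ioi 0)).withDensity fun t ↦ ENNReal.ofReal (Real.exp (-t)), ?_, ?_, ?_,
    fun T ↦ ?_⟩
  · have h : IntegrableOn (fun t : ℝ ↦ Real.exp (-t)) (Ioi 0) := integrableOn_exp_neg_Ioi 0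
    exact isFiniteMeasure_withDensity_ofReal h.2
  · conv_rhs => rw [← withDensity_one (μ := volume.restrict (Ioi (0 : ℝ)))]
    refine withDensity_mono ?_
    filter_upwards [ae_restrict_mem measurableSet_Ioi] with t ht
    have ht : 0 < t := ht
    simpa using ht.le
  · refine withDensity_absolutelyContinuous' hm.aemeasurable (Eventually.of_forall fun t ↦ ?_)
    simp [Real.exp_pos]
  · rw [← withDensity_smul _ hm]
    have : volume.restrict (Ioc 0 T) = (volume.restrict (Ioi 0)).withDensity
        ((Ioc 0 T).indicator 1) := by
      rw [withDensity_indicator_one measurableSet_Ioc, Measure.restrict_restrict measurableSet_Ioc,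
        inter_eq_left.2 fun t ht ↦ ht.1]
    rw [this]
    refine withDensity_mono (Eventually.of_forall fun t ↦ ?_)
    by_cases ht : t ∈ Ioc 0 T
    · simp only [ht, indicator_of_mem, Pi.one_apply, Pi.smul_apply, smul_eq_mul]
      rw [← ENNReal.ofReal_mul (Real.exp_nonneg _), ← Real.exp_add]
      simpa using ht.2
    · simp [ht]

variable {E : Type*} [NormedAddCommGroup E]

/-- Pairs of functions `(G, Λ)` with `Λ` dominating `α ‖G‖ ^ θ` and of integral at most `c`. -/
def coercivePairs (E : Type*) [NormedAddCommGroup E] (α θ : ℝ) (c : ℝ≥0∞) :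
    Set ((ℝ → E) × (ℝ → ℝ)) :=
  {z | AEStronglyMeasurable z.1 (volume.restrict (Ioi 0)) ∧
    AEMeasurable z.2 (volume.restrict (Ioi 0)) ∧ (∀ t > 0, α * ‖z.1 t‖ ^ θ ≤ z.2 t) ∧
      ∫⁻ t in Ioi 0, ENNReal.ofReal (z.2 t) ≤ c}

lemma coercivePairs_norm_rpow_bound {α θ : ℝ} (hα : 0 < α) {c : ℝ≥0∞} (hc : c ≠ ⊤)
    {ν : Measure ℝ} (hν : ν ≤ volume.restrict (Ioi 0)) {z : (ℝ → E) × (ℝ → ℝ)}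
    (hz : z ∈ coercivePairs E α θ c) :
    Integrable (fun t ↦ ‖z.1 t‖ ^ θ) ν ∧ ∫ t, ‖z.1 t‖ ^ θ ∂ν ≤ (ENNReal.ofReal α⁻¹ * c).toReal := by
  obtain ⟨hG, hΛ, hGΛ, hle⟩ := hz
  have hmeas : AEStronglyMeasurable (fun t ↦ ‖z.1 t‖ ^ θ) ν :=
    ((hG.mono_measure hν).norm.aemeasurable.pow_const θ).aestronglyMeasurable
  have hnn : ∀ t, 0 ≤ ‖z.1 t‖ ^ θ := fun t ↦ by positivity
  have hbound : ∫⁻ t, ENNReal.ofReal (‖z.1 t‖ ^ θ) ∂ν ≤ ENNReal.ofReal α⁻¹ * c := by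
    calc ∫⁻ t, ENNReal.ofReal (‖z.1 t‖ ^ θ) ∂ν
        ≤ ∫⁻ t in Ioi 0, ENNReal.ofReal (‖z.1 t‖ ^ θ) := lintegral_mono' hν le_rfl
      _ ≤ ∫⁻ t in Ioi 0, ENNReal.ofReal α⁻¹ * ENNReal.ofReal (z.2 t) := by
        refine setLIntegral_mono' measurableSet_Ioi fun t ht ↦ ?_
        rw [← ENNReal.ofReal_mul (by positivity)]
        apply ENNReal.ofReal_le_ofReal
        rw [le_inv_mul_iff₀ hα]
        exact hGΛ t ht
      _ = ENNReal.ofReal α⁻¹ * ∫⁻ t in Ioi 0, ENNReal.ofReal (z.2 t) :=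
        lintegral_const_mul'' _ hΛ.ennreal_ofReal
      _ ≤ _ := by gcongr
  have hfin : ENNReal.ofReal α⁻¹ * c ≠ ⊤ := ENNReal.mul_ne_top ENNReal.ofReal_ne_top hc
  constructor
  · rw [← lintegral_ofReal_ne_top_iff_integrable hmeas (Eventually.of_forall hnn)]
    exact ne_top_of_le_ne_top hfin hbound
  · rw [integral_eq_lintegral_of_nonneg_ae (Eventually.of_forall hnn) hmeas]
    exact ENNReal.toReal_mono hfin hbound

variable [NormedSpace ℝ E]

lemma convex_coercivePairs {α θ : ℝ} (hα : 0 < α) (hθ : 1 < θ) (c : ℝ≥0∞) :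
    Convex ℝ (coercivePairs E α θ c) := by
  rintro ⟨G, Λ⟩ ⟨hG, hΛ, hGΛ, hc⟩ ⟨G', Λ'⟩ ⟨hG', hΛ', hGΛ', hc'⟩ r s hr hs hrs
  refine ⟨(hG.const_smul r).add (hG'.const_smul s), (hΛ.const_smul r).add (hΛ'.const_smul s),
    fun t ht ↦ ?_, ?_⟩
  · have h : ‖r • G t + s • G' t‖ ^ θ ≤ r * ‖G t‖ ^ θ + s * ‖G' t‖ ^ θ := by
      calc ‖r • G t + s • G' t‖ ^ θ ≤ (r * ‖G t‖ + s * ‖G' t‖) ^ θ := by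
            gcongr
            exact convexOn_univ_norm.2 (mem_univ _) (mem_univ _) hr hs hrs
        _ ≤ _ := (convexOn_rpow hθ.le).2 (norm_nonneg _) (norm_nonneg _) hr hs hrs
    have h1 := hGΛ t ht
    have h2 := hGΛ' t ht
    simp only at h1 h2
    calc α * ‖r • G t + s • G' t‖ ^ θ ≤ α * (r * ‖G t‖ ^ θ + s * ‖G' t‖ ^ θ) := by gcongr
      _ = r * (α * ‖G t‖ ^ θ) + s * (α * ‖G' t‖ ^ θ) := by ring
      _ ≤ r * Λ t + s * Λ' t := by gcongr
  · calc ∫⁻ t in Ioi 0, ENNReal.ofReal (r * Λ t + s * Λ' t)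
        ≤ ∫⁻ t in Ioi 0, (ENNReal.ofReal r * ENNReal.ofReal (Λ t) +
            ENNReal.ofReal s * ENNReal.ofReal (Λ' t)) := by
          refine lintegral_mono fun t ↦ ?_
          rw [← ENNReal.ofReal_mul hr, ← ENNReal.ofReal_mul hs]
          exact ENNReal.ofReal_add_le
      _ = ENNReal.ofReal r * (∫⁻ t in Ioi 0, ENNReal.ofReal (Λ t)) +
            ENNReal.ofReal s * ∫⁻ t in Ioi 0, ENNReal.ofReal (Λ' t) := by
          rw [lintegral_add_left' (hΛ.ennreal_ofReal.const_mul _),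
            lintegral_const_mul'' _ hΛ.ennreal_ofReal, lintegral_const_mul'' _ hΛ'.ennreal_ofReal]
      _ ≤ ENNReal.ofReal r * c + ENNReal.ofReal s * c := by gcongr
      _ = c := by rw [← add_mul, ← ENNReal.ofReal_add hr hs, hrs, ENNReal.ofReal_one, one_mul]

lemma convex_setOf_norm_setIntegral_sub_le (S : Set ℝ) (v : E) (ε : ℝ) :
    Convex ℝ {z : (ℝ → E) × (ℝ → ℝ) | IntegrableOn z.1 S ∧ ‖(∫ t in S, z.1 t) - v‖ ≤ ε} := by
  rintro ⟨G, Λ⟩ ⟨hG, hv⟩ ⟨G', Λ'⟩ ⟨hG', hv'⟩ r s hr hs hrs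
  refine ⟨(hG.smul r).add (hG'.smul s), ?_⟩
  have h : ∫ t in S, (r • (G, Λ) + s • (G', Λ')).1 t =
      r • (∫ t in S, G t) + s • ∫ t in S, G' t := by
    rw [← integral_smul, ← integral_smul]
    exact integral_add (hG.smul r) (hG'.smul s)
  have h' := (convex_closedBall v ε) (mem_closedBall_iff_norm.2 hv) (mem_closedBall_iff_norm.2 hv')
    hr hs hrs
  rw [h]
  exact mem_closedBall_iff_norm.1 h'

lemma convex_setOf_affine_le (A : E →L[ℝ] ℝ) (b t : ℝ) :
    Convex ℝ {z : (ℝ → E) × (ℝ → ℝ) | A (z.1 t) + b ≤ z.2 t} := by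
  rintro ⟨G, Λ⟩ h ⟨G', Λ'⟩ h' r s hr hs hrs
  simp only [mem_ofPred_eq] at h h'
  have : A (r • G t + s • G' t) + b ≤ r * Λ t + s * Λ' t := by
    rw [map_add, map_smul, map_smul, smul_eq_mul, smul_eq_mul]
    calc _ = r * (A (G t) + b) + s * (A (G' t) + b) := by linear_combination (-b) * hrs
      _ ≤ _ := by gcongr
  exact this

lemma HasVel.aestronglyMeasurable {Ω : Set (EucSp d)} {γ : CurveSp Ω} {g : ℝ → EucSp d}
    (h : HasVel γ g) : AEStronglyMeasurable g (volume.restrict (Ioi 0)) := by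
  have hU : AEStronglyMeasurable g (volume.restrict (⋃ n : ℕ, Icc (0 : ℝ) n)) :=
    aestronglyMeasurable_iUnion_iff.2 fun n ↦ (h.1 n).1
  refine hU.mono_set fun t ht ↦ ?_
  obtain ⟨n, hn⟩ := exists_nat_ge t
  exact mem_iUnion.2 ⟨n, le_of_lt ht, hn⟩

end RunningCost

section LowerSemicontinuity

variable {Ω : Set (EucSp d)} {ℓ : ℝ → EucSp d → EucSp d → ℝ}

lemma CurveSp.tendsto_apply {γs : ℕ → CurveSp Ω} {γ : CurveSp Ω}
    (h : Tendsto γs atTop (𝓝 γ)) (t : ℝ≥0) :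
    Tendsto (fun n ↦ (γs n).1 t) atTop (𝓝 (γ.1 t)) :=
  (((continuous_eval_const t).comp continuous_subtype_val).tendsto γ).comp h

lemma aemeasurable_lagrangian (hℓmeas : ∀ x p, Measurable fun t : ℝ => ℓ t x p)
    (hℓcont : ∀ᵐ t ∂(volume.restrict (Set.Ioi (0 : ℝ))),
      ContinuousOn (fun q : EucSp d × EucSp d => ℓ t q.1 q.2)
        ((closure Ω) ×ˢ (Set.univ : Set (EucSp d))))
    (γ : CurveSp Ω) {g : ℝ → EucSp d}
    (hg : AEStronglyMeasurable g (volume.restrict (Ioi 0))) :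
    AEMeasurable (fun t : ℝ ↦ ℓ t (γ.1 t.toNNReal) (g t)) (volume.restrict (Ioi 0)) := by
  have hcont : ∀ᵐ t ∂(volume.restrict (Ioi (0 : ℝ))),
      Continuous fun y : closure Ω × EucSp d ↦ ℓ t y.1 y.2 := by
    filter_upwards [hℓcont] with t ht
    exact ht.comp_continuous (f := fun y : closure Ω × EucSp d ↦ ((y.1 : EucSp d), y.2))
      (by fun_prop) fun y ↦ ⟨y.1.2, mem_univ _⟩
  have hγ : Continuous fun t : ℝ ↦ (⟨γ.1 t.toNNReal, γ.2 _⟩ : closure Ω) := by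
    refine Continuous.subtype_mk (γ.1.continuous.comp continuous_real_toNNReal) _
  exact aemeasurable_caratheodory_comp (f := fun t (y : closure Ω × EucSp d) ↦ ℓ t y.1 y.2)
    (fun y ↦ hℓmeas _ _) hcont (hγ.aemeasurable.prodMk hg.aemeasurable)

/-- Forward convex combinations of the velocities `g n` and of the associated running costs
along curves `γs n`. -/
def forwardHull (ℓ : ℝ → EucSp d → EucSp d → ℝ) (γs : ℕ → CurveSp Ω) (g : ℕ → ℝ → EucSp d)
    (m : ℕ) : Set ((ℝ → EucSp d) × (ℝ → ℝ)) :=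
  convexHull ℝ ((fun n ↦ (g n, fun t : ℝ ↦ ℓ t ((γs n).1 t.toNNReal) (g n t))) '' Ici m)

lemma forwardHull_subset {γs : ℕ → CurveSp Ω} {g : ℕ → ℝ → EucSp d} {m : ℕ}
    {S : Set ((ℝ → EucSp d) × (ℝ → ℝ))} (hS : Convex ℝ S)
    (h : ∀ n ≥ m, (g n, fun t : ℝ ↦ ℓ t ((γs n).1 t.toNNReal) (g n t)) ∈ S) :
    forwardHull ℓ γs g m ⊆ S :=
  convexHull_min (image_subset_iff.2 h) hS

lemma forwardHull_antitone (γs : ℕ → CurveSp Ω) (g : ℕ → ℝ → EucSp d) :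
    Antitone (forwardHull ℓ γs g) := fun _ _ h ↦
  convexHull_mono (image_mono (Ici_subset_Ici.2 h))

/-- Pointwise lower bound for the limit of forward convex combinations. -/
lemma ofReal_le_liminf_forwardHull (hΩ : IsCompact (closure Ω)) {α θ : ℝ} (hα : 0 < α)
    (hθ : 1 < θ) {t : ℝ}
    (hcont : ContinuousOn (fun q : EucSp d × EucSp d => ℓ t q.1 q.2) (closure Ω ×ˢ univ))
    (hconv : ∀ x ∈ closure Ω, ConvexOn ℝ univ fun p => ℓ t x p)
    (hlb : ∀ x ∈ closure Ω, ∀ p, α * ‖p‖ ^ θ ≤ ℓ t x p)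
    {γs : ℕ → CurveSp Ω} {γ : CurveSp Ω} (hγ : Tendsto γs atTop (𝓝 γ)) {g : ℕ → ℝ → EucSp d}
    {ns : ℕ → ℕ} (hns : Tendsto ns atTop atTop) {z : ℕ → (ℝ → EucSp d) × (ℝ → ℝ)}
    (hz : ∀ i, z i ∈ forwardHull ℓ γs g (ns i)) {p : EucSp d}
    (hp : Tendsto (fun i ↦ (z i).1 t) atTop (𝓝 p)) :
    ENNReal.ofReal (ℓ t (γ.1 t.toNNReal) p) ≤
      liminf (fun i ↦ ENNReal.ofReal ((z i).2 t)) atTop := by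
  set x := γ.1 t.toNNReal
  have hbelow : ∀ ε > 0, ENNReal.ofReal (ℓ t x p - ε) ≤
      liminf (fun i ↦ ENNReal.ofReal ((z i).2 t)) atTop := by
    intro ε hε
    obtain ⟨A, b, hA, hnear⟩ := exists_affine_minorant_near hΩ hα hθ hcont (γ.2 t.toNNReal)
      (hconv x (γ.2 _)) hlb p (half_pos hε)
    have hx : Tendsto (fun n ↦ (γs n).1 t.toNNReal) atTop (𝓝[closure Ω] x) :=
      tendsto_nhdsWithin_iff.2 ⟨CurveSp.tendsto_apply hγ _, Eventually.of_forall fun n ↦ (γs n).2 _⟩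
    obtain ⟨N, hN⟩ := eventually_atTop.1 (hx.eventually hnear)
    have hlim : Tendsto (fun i ↦ A ((z i).1 t) + b) atTop (𝓝 (A p + b)) :=
      ((A.continuous.tendsto p).comp hp).add_const b
    refine le_liminf_of_le (by isBoundedDefault) ?_
    filter_upwards [hns.eventually_ge_atTop N,
      hlim.eventually_const_lt (show ℓ t x p - ε < A p + b by linarith)] with i hi hi'
    have : A ((z i).1 t) + b ≤ (z i).2 t :=
      forwardHull_subset (convex_setOf_affine_le A b t)
        (fun n hn ↦ hN n (hi.trans hn) (g n t)) (hz i)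
    exact ENNReal.ofReal_le_ofReal (hi'.le.trans this)
  have hlim : Tendsto (fun ε : ℝ ↦ ENNReal.ofReal (ℓ t x p - ε)) (𝓝[>] 0)
      (𝓝 (ENNReal.ofReal (ℓ t x p - 0))) := by
    exact tendsto_nhdsWithin_of_tendsto_nhds
      (ENNReal.tendsto_ofReal (tendsto_id.const_sub (ℓ t x p)))
  rw [sub_zero] at hlim
  refine le_of_tendsto hlim ?_
  filter_upwards [self_mem_nhdsWithin] with ε hε using hbelow ε hε

/-- An `L¹` limit of forward convex combinations of the velocities of `γs n` is a velocity of the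
limit of `γs n`. -/
lemma hasVel_of_tendsto_forwardHull {γs : ℕ → CurveSp Ω} {γ : CurveSp Ω}
    (hγ : Tendsto γs atTop (𝓝 γ)) {g : ℕ → ℝ → EucSp d} (hg : ∀ n, HasVel (γs n) (g n))
    {ν : Measure ℝ} {M : ℝ → ℝ≥0∞} (hM : ∀ T, M T ≠ ⊤)
    (hν : ∀ T : ℝ, volume.restrict (Ioc 0 T) ≤ M T • ν)
    {z : ℕ → (ℝ → EucSp d) × (ℝ → ℝ)} (hz : ∀ m, z m ∈ forwardHull ℓ γs g m)
    {G : ℝ → EucSp d} (hG : Integrable G ν)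
    (hlim : Tendsto (fun m ↦ eLpNorm ((z m).1 - G) 1 ν) atTop (𝓝 0)) : HasVel γ G := by
  have hGint : ∀ T, IntegrableOn G (Ioc 0 T) := fun T ↦
    (hG.smul_measure (hM T)).mono_measure (hν T)
  refine ⟨fun T ↦ (integrableOn_Icc_iff_integrableOn_Ioc (by simp)).2 (hGint T), fun t ↦ ?_⟩
  have hclose : ∀ ε > 0, ∃ N, ∀ m ≥ N, IntegrableOn (z m).1 (Ioc 0 (t : ℝ)) ∧
      ‖(∫ s in Ioc 0 (t : ℝ), (z m).1 s) - (γ.1 t - γ.1 0)‖ ≤ ε := by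
    intro ε hε
    have h : Tendsto (fun n ↦ (γs n).1 t - (γs n).1 0) atTop (𝓝 (γ.1 t - γ.1 0)) :=
      (CurveSp.tendsto_apply hγ t).sub (CurveSp.tendsto_apply hγ 0)
    obtain ⟨N, hN⟩ := eventually_atTop.1 (h.eventually (Metric.closedBall_mem_nhds _ hε))
    refine ⟨N, fun m hm ↦ forwardHull_subset
      (convex_setOf_norm_setIntegral_sub_le (Ioc 0 (t : ℝ)) (γ.1 t - γ.1 0) ε)
      (fun n hn ↦ ⟨((hg n).1 t).mono_set Ioc_subset_Icc_self, ?_⟩) (hz m)⟩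
    have h1 : ∫ s in Ioc 0 (t : ℝ), g n s = (γs n).1 t - (γs n).1 0 := by
      rw [(hg n).2 t, add_sub_cancel_left]
    simp only [h1]
    exact mem_closedBall_iff_norm.1 (hN n (hm.trans hn))
  have hint : ∀ᶠ m in atTop, IntegrableOn (z m).1 (Ioc 0 (t : ℝ)) := by
    obtain ⟨N, hN⟩ := hclose 1 one_pos
    exact eventually_atTop.2 ⟨N, fun m hm ↦ (hN m hm).1⟩
  have hlim1 : Tendsto (fun m ↦ ∫ s in Ioc 0 (t : ℝ), (z m).1 s) atTop
      (𝓝 (γ.1 t - γ.1 0)) := by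
    refine Metric.tendsto_atTop'.2 fun ε hε ↦ ?_
    obtain ⟨N, hN⟩ := hclose (ε / 2) (half_pos hε)
    refine ⟨N, fun m hm ↦ ?_⟩
    rw [dist_eq_norm]
    exact (hN m hm.le).2.trans_lt (half_lt_self hε)
  have hlim2 : Tendsto (fun m ↦ ∫ s in Ioc 0 (t : ℝ), (z m).1 s) atTop
      (𝓝 (∫ s in Ioc 0 (t : ℝ), G s)) := by
    refine tendsto_integral_of_L1' G (hGint t).1 hint ?_
    have h0 : Tendsto (fun m ↦ M t * eLpNorm ((z m).1 - G) 1 ν) atTop (𝓝 0) := by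
      simpa using ENNReal.Tendsto.const_mul hlim (Or.inr (hM t))
    refine tendsto_of_tendsto_of_tendsto_of_le_of_le tendsto_const_nhds h0
      (fun _ ↦ zero_le) fun m ↦ ?_
    refine (eLpNorm_mono_measure _ (hν t)).trans_eq ?_
    rw [eLpNorm_one_smul_measure]
  rw [tendsto_nhds_unique hlim2 hlim1, add_sub_cancel]

/-- A limit of curves of running cost at most `c` has running cost at most `c`. -/
lemma runningCost_le_of_tendsto (hΩ : IsCompact (closure Ω))
    (hℓmeas : ∀ x p, Measurable fun t : ℝ => ℓ t x p)
    (hℓcont : ∀ᵐ t ∂(volume.restrict (Set.Ioi (0 : ℝ))),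
      ContinuousOn (fun q : EucSp d × EucSp d => ℓ t q.1 q.2)
        ((closure Ω) ×ˢ (Set.univ : Set (EucSp d))))
    (hℓconv : ∀ᵐ t ∂(volume.restrict (Set.Ioi (0 : ℝ))), ∀ x ∈ closure Ω,
      ConvexOn ℝ Set.univ fun p => ℓ t x p)
    {α θ : ℝ} (hα : 0 < α) (hθ : 1 < θ)
    (hℓlb : ∀ t ∈ Set.Ici (0 : ℝ), ∀ x ∈ closure Ω, ∀ p, α * ‖p‖ ^ θ ≤ ℓ t x p)
    {γs : ℕ → CurveSp Ω} {γ : CurveSp Ω} (hγ : Tendsto γs atTop (𝓝 γ)) {c : ℝ≥0∞}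
    (hc : ∀ n, ⨅ (g : ℝ → EucSp d) (_ : HasVel (γs n) g),
      ∫⁻ t in Ioi (0 : ℝ), ENNReal.ofReal (ℓ t ((γs n).1 t.toNNReal) (g t)) ≤ c) :
    ⨅ (g : ℝ → EucSp d) (_ : HasVel γ g),
      ∫⁻ t in Ioi (0 : ℝ), ENNReal.ofReal (ℓ t (γ.1 t.toNNReal) (g t)) ≤ c := by
  rcases eq_or_ne c ⊤ with rfl | hctop
  · exact le_top
  let e : ℕ → ℝ≥0∞ := fun n ↦ c + ((n : ℝ≥0∞) + 1)⁻¹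
  have he_anti : Antitone e := fun m n h ↦ by simp only [e]; gcongr
  have he_top : ∀ n, e n ≠ ⊤ := fun n ↦ by simp [e, hctop]
  have he_lim : Tendsto e atTop (𝓝 c) := by
    have h : Tendsto (fun n : ℕ ↦ ((n : ℝ≥0∞) + 1)⁻¹) atTop (𝓝 0) := by
      have := (tendsto_add_atTop_iff_nat 1).2 ENNReal.tendsto_inv_nat_nhds_zero
      simpa using this
    simpa using h.const_add c
  have hex : ∀ n, ∃ g, HasVel (γs n) g ∧
      ∫⁻ t in Ioi (0 : ℝ), ENNReal.ofReal (ℓ t ((γs n).1 t.toNNReal) (g t)) < e n := by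
    intro n
    have hlt : c < e n := ENNReal.lt_add_right hctop (by simp)
    obtain ⟨g, hg⟩ := iInf_lt_iff.1 ((hc n).trans_lt hlt)
    obtain ⟨hvel, hg⟩ := iInf_lt_iff.1 hg
    exact ⟨g, hvel, hg⟩
  choose g hvel hcost using hex
  have hmem : ∀ m n, m ≤ n → (g n, fun t : ℝ ↦ ℓ t ((γs n).1 t.toNNReal) (g n t)) ∈
      coercivePairs (EucSp d) α θ (e m) := fun m n h ↦
    ⟨(hvel n).aestronglyMeasurable,
      aemeasurable_lagrangian hℓmeas hℓcont _ (hvel n).aestronglyMeasurable,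
      fun t ht ↦ hℓlb t (le_of_lt ht) _ ((γs n).2 _) _, (hcost n).le.trans (he_anti h)⟩
  have hsub : ∀ m, forwardHull ℓ γs g m ⊆ coercivePairs (EucSp d) α θ (e m) := fun m ↦
    forwardHull_subset (convex_coercivePairs hα hθ _) fun n hn ↦ hmem m n hn
  obtain ⟨ν, hνfin, hνle, hνac, hνT⟩ := exists_isFiniteMeasure_halfLine
  obtain ⟨F, hF, G, hGint, hFG⟩ := exists_tendsto_eLpNorm_of_antitone_convex (ν := ν) hθ
    (K := fun m ↦ Prod.fst '' forwardHull ℓ γs g m)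
    (fun m n h ↦ image_mono (forwardHull_antitone γs g h))
    (fun m ↦ (convex_convexHull ℝ _).linear_image (LinearMap.fst ℝ (ℝ → EucSp d) (ℝ → ℝ)))
    (fun m ↦ ((nonempty_Ici.image _).convexHull).image _)
    (by rintro _ ⟨z, hz, rfl⟩; exact (hsub 0 hz).1.mono_measure hνle)
    (by
      rintro _ ⟨z, hz, rfl⟩
      exact (coercivePairs_norm_rpow_bound hα (he_top 0) hνle (hsub 0 hz)).1)
    (by
      rintro _ ⟨z, hz, rfl⟩
      exact (coercivePairs_norm_rpow_bound hα (he_top 0) hνle (hsub 0 hz)).2)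
  choose z hz hzF using hF
  obtain rfl : (fun m ↦ (z m).1) = F := funext hzF
  have hGvel : HasVel γ G := hasVel_of_tendsto_forwardHull hγ hvel
    (fun T ↦ ENNReal.ofReal_ne_top) hνT hz hGint hFG
  obtain ⟨ns, hns, hae⟩ := (tendstoInMeasure_of_tendsto_eLpNorm one_ne_zero
    (fun m ↦ (hsub m (hz m)).1.mono_measure hνle) hGint.1 hFG).exists_seq_tendsto_ae
  refine iInf₂_le_of_le G hGvel ?_
  calc ∫⁻ t in Ioi (0 : ℝ), ENNReal.ofReal (ℓ t (γ.1 t.toNNReal) (G t))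
      ≤ ∫⁻ t in Ioi (0 : ℝ), liminf (fun i ↦ ENNReal.ofReal ((z (ns i)).2 t)) atTop := by
        refine lintegral_mono_ae ?_
        filter_upwards [hνac.ae_le hae, hℓcont, hℓconv, ae_restrict_mem measurableSet_Ioi]
          with t h1 h2 h3 h4
        have ht : t ∈ Ici (0 : ℝ) := Ioi_subset_Ici_self h4
        exact ofReal_le_liminf_forwardHull hΩ hα hθ h2 h3 (hℓlb t ht) hγ
          hns.tendsto_atTop (fun i ↦ hz (ns i)) h1
    _ ≤ liminf (fun i ↦ ∫⁻ t in Ioi (0 : ℝ), ENNReal.ofReal ((z (ns i)).2 t)) atTop :=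
        lintegral_liminf_le' fun i ↦ (hsub _ (hz (ns i))).2.1.ennreal_ofReal
    _ ≤ liminf (fun i ↦ e (ns i)) atTop :=
        liminf_le_liminf (Eventually.of_forall fun i ↦ (hsub _ (hz (ns i))).2.2.2)
    _ = c := (he_lim.comp hns.tendsto_atTop).liminf_eq

end LowerSemicontinuity

/-- Corollary `coro:L-lsc`: under (H1), (H2), (H3), (H5), the individual cost `L` is lower semicontinuous on `Γ`. -/
theorem Lcost_lowerSemicontinuous {d : ℕ}
    (Ω : Set (EucSp d)) (hΩne : Ω.Nonempty) (hΩop : IsOpen Ω)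
    (hΩbd : Bornology.IsBounded Ω)
    (Ξ : Set (EucSp d)) (hΞne : Ξ.Nonempty) (hΞcl : IsClosed Ξ) (hΞsub : Ξ ⊆ closure Ω)
    (ℓ : ℝ → EucSp d → EucSp d → ℝ)
    (hℓmeas : ∀ x p, Measurable fun t : ℝ => ℓ t x p)
    (hℓcont : ∀ᵐ t ∂(volume.restrict (Set.Ioi (0 : ℝ))),
      ContinuousOn (fun q : EucSp d × EucSp d => ℓ t q.1 q.2)
        ((closure Ω) ×ˢ (Set.univ : Set (EucSp d))))
    (hℓconv : ∀ᵐ t ∂(volume.restrict (Set.Ioi (0 : ℝ))), ∀ x ∈ closure Ω,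
      ConvexOn ℝ Set.univ fun p => ℓ t x p)
    (hℓnn : ∀ t ∈ Set.Ici (0 : ℝ), ∀ x ∈ closure Ω, ∀ p, 0 ≤ ℓ t x p)
    (α θ : ℝ) (hα : 0 < α) (hθ : 1 < θ)
    (hℓlb : ∀ t ∈ Set.Ici (0 : ℝ), ∀ x ∈ closure Ω, ∀ p, α * ‖p‖ ^ θ ≤ ℓ t x p)
    (Ψ : ℝ → ℝ) (hΨnn : ∀ t ∈ Set.Ici (0 : ℝ), 0 ≤ Ψ t)
    (hΨlsc : LowerSemicontinuousOn Ψ (Set.Ici 0)) (hΨmono : MonotoneOn Ψ (Set.Ici 0))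
    (a b : ℝ) (ha : 0 < a) (hb : 0 < b)
    (hΨlb : ∀ t ∈ Set.Ici (0 : ℝ), a * t - b ≤ Ψ t) :
    LowerSemicontinuous fun γ : CurveSp Ω => Lcost ℓ Ψ Ξ γ := by
  have hΩcomp : IsCompact (closure Ω) := hΩbd.isCompact_closure
  refine LowerSemicontinuous.add ?_ (lowerSemicontinuous_psiExt_exitT hΞcl hΨlsc)
  refine lowerSemicontinuous_iff_isClosed_preimage.2 fun c ↦ IsSeqClosed.isClosed ?_
  exact fun γs γ hc hγ ↦
    runningCost_le_of_tendsto hΩcomp hℓmeas hℓcont hℓconv hα hθ hℓlb hγ hc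

end
end
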